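/- Fix α > 0 and d > 0. There exist a function r : (0, ∞) → ℝ, infinitely differentiable, satisfying 2s² r' r''' − s² (r'')² + 2s r' r'' − 4s (r')³ + (2r − 1/4)(r')² + 1 = 0 on (0, ∞), with lim_{s→0⁺} r(s) = (1 − 4α²)/8 and r(s) − ((3/2) s^{2/3} − α s^{1/3}) bounded as s → +∞, and constants C > 0 and N ∈ ℕ, such that for every integer n ≥ N and every t ∈ (0, d], writing s = 2nt, the logarithmic derivative of the Hankel determinant satisfies H_n(t) = −((8 r(s) + 4α² − 1)/16) (1 + ε_n(t)) with |ε_n(t)| ≤ C n^{−1/3}. -/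

import Mathlib

open MeasureTheory Set Filter Topology

/-- The singularly perturbed Laguerre weight `w(x; t, α) = x^α e^{-x - t/x}`. -/
noncomputable def pertLagWeight (α t x : ℝ) : ℝ := x ^ α * Real.exp (-x - t / x)

/-- The `j`-th moment `μ_j(t) = ∫_0^∞ x^j w(x; t, α) dx`. -/
noncomputable def pertLagMoment (α t : ℝ) (j : ℕ) : ℝ :=
  ∫ x in Set.Ioi (0:ℝ), x ^ j * pertLagWeight α t x

/-- The Hankel determinant `D_n[w; t] = det(μ_{j+k}(t))_{j,k=0}^{n-1}`. -/
noncomputable def hankelDet (α : ℝ) (n : ℕ) (t : ℝ) : ℝ :=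
  (Matrix.of (fun j k : Fin n => pertLagMoment α t (j.1 + k.1))).det

/-- `H_n(t) = t (d/dt) ln D_n[w; t]`. -/
noncomputable def Hlog (α : ℝ) (n : ℕ) (t : ℝ) : ℝ :=
  t * deriv (fun τ => Real.log (hankelDet α n τ)) t

/-- The moment `∫_0^∞ x^β e^{-x - t/x} dx` with real exponent `β`. -/
noncomputable def weightIntegral (β t : ℝ) : ℝ :=
  ∫ x in Ioi (0:ℝ), pertLagWeight β t x

lemma pertLagWeight_pos (β t : ℝ) {x : ℝ} (hx : 0 < x) : 0 < pertLagWeight β t x :=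
  mul_pos (Real.rpow_pos_of_pos hx _) (Real.exp_pos _)

lemma pertLagWeight_anti (β : ℝ) {s t x : ℝ} (hst : s ≤ t) (hx : 0 < x) :
    pertLagWeight β t x ≤ pertLagWeight β s x := by
  unfold pertLagWeight
  gcongr

lemma pow_mul_pertLagWeight (β t : ℝ) (j : ℕ) {x : ℝ} (hx : 0 < x) :
    x ^ j * pertLagWeight β t x = pertLagWeight (β + j) t x := by
  unfold pertLagWeight
  rw [Real.rpow_add hx, Real.rpow_natCast]
  ring

lemma pertLagMoment_eq (α t : ℝ) (j : ℕ) :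
    pertLagMoment α t j = weightIntegral (α + j) t :=
  setIntegral_congr_fun measurableSet_Ioi fun _ hx => pow_mul_pertLagWeight α t j hx

lemma continuousOn_pertLagWeight (β t : ℝ) : ContinuousOn (pertLagWeight β t) (Ioi 0) := by
  intro x hx
  have hx' : x ≠ 0 := (ne_of_gt hx)
  unfold pertLagWeight
  exact ((Real.continuousAt_rpow_const x β (Or.inl hx')).mul
    (by fun_prop (disch := assumption))).continuousWithinAt

lemma pertLagWeight_le (β : ℝ) {t x : ℝ} (ht : 0 < t) (k : ℕ) (hx : 0 < x) :
    pertLagWeight β t x ≤ (k.factorial / t ^ k) * (Real.exp (-x) * x ^ (β + k)) := by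
  have h1 : (t / x) ^ k / k.factorial ≤ Real.exp (t / x) :=
    Real.pow_div_factorial_le_exp _ (by positivity) k
  have h2 : Real.exp (-(t / x)) ≤ k.factorial / t ^ k * x ^ k := by
    rw [Real.exp_neg, inv_le_comm₀ (Real.exp_pos _) (by positivity)]
    refine le_trans (le_of_eq ?_) h1
    rw [div_pow]
    field_simp
  have h3 : Real.exp (-x - t / x) = Real.exp (-x) * Real.exp (-(t / x)) := by
    rw [← Real.exp_add]; ring_nf
  unfold pertLagWeight
  rw [h3, Real.rpow_add hx, Real.rpow_natCast]
  calc x ^ β * (Real.exp (-x) * Real.exp (-(t / x)))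
      ≤ x ^ β * (Real.exp (-x) * (k.factorial / t ^ k * x ^ k)) := by gcongr
    _ = _ := by ring

lemma integrableOn_pertLagWeight (β : ℝ) {t : ℝ} (ht : 0 < t) :
    IntegrableOn (pertLagWeight β t) (Ioi 0) := by
  obtain ⟨k, hk⟩ := exists_nat_gt (-β)
  have hG := (Real.GammaIntegral_convergent (s := β + k + 1) (by linarith)).const_mul
    (k.factorial / t ^ k)
  refine Integrable.mono' hG
    ((continuousOn_pertLagWeight β t).aestronglyMeasurable measurableSet_Ioi) ?_
  filter_upwards [ae_restrict_mem measurableSet_Ioi] with x hx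
  rw [Real.norm_of_nonneg (pertLagWeight_pos β t hx).le]
  simpa using pertLagWeight_le β ht k hx

lemma hasDerivAt_pertLagWeight_param (β : ℝ) {x : ℝ} (hx : 0 < x) (τ : ℝ) :
    HasDerivAt (fun t => pertLagWeight β t x) (-pertLagWeight (β - 1) τ x) τ := by
  unfold pertLagWeight
  refine ((((hasDerivAt_id τ).div_const x).const_sub (-x)).exp.const_mul (x ^ β)).congr_deriv ?_
  rw [Real.rpow_sub hx, Real.rpow_one]
  simp only [id]
  ring

lemma hasDerivAt_weightIntegral (β : ℝ) {t : ℝ} (ht : 0 < t) :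
    HasDerivAt (weightIntegral β) (-weightIntegral (β - 1) t) t := by
  unfold weightIntegral
  rw [← integral_neg]
  refine (hasDerivAt_integral_of_dominated_loc_of_deriv_le (s := Ioi (t / 2))
    (bound := fun x => pertLagWeight (β - 1) (t / 2) x)
    (F' := fun τ x => -pertLagWeight (β - 1) τ x)
    (Ioi_mem_nhds (by linarith)) ?_ (integrableOn_pertLagWeight β ht) ?_ ?_
    (integrableOn_pertLagWeight (β - 1) (by linarith)) ?_).2
  · exact Eventually.of_forall fun τ =>
      (continuousOn_pertLagWeight β τ).aestronglyMeasurable measurableSet_Ioi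
  · exact ((continuousOn_pertLagWeight (β - 1) t).aestronglyMeasurable measurableSet_Ioi).neg
  · filter_upwards [ae_restrict_mem measurableSet_Ioi] with x hx τ hτ
    rw [norm_neg, Real.norm_of_nonneg (pertLagWeight_pos _ _ hx).le]
    exact pertLagWeight_anti _ (le_of_lt hτ) hx
  · filter_upwards [ae_restrict_mem measurableSet_Ioi] with x hx τ _
    exact hasDerivAt_pertLagWeight_param β hx τ

lemma hasDerivAt_pertLagWeight (β t : ℝ) {x : ℝ} (hx : 0 < x) :
    HasDerivAt (pertLagWeight β t)
      (β * pertLagWeight (β - 1) t x - pertLagWeight β t x + t * pertLagWeight (β - 2) t x) x := by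
  have h1 := Real.hasDerivAt_rpow_const (x := x) (p := β) (Or.inl hx.ne')
  have h2 : HasDerivAt (fun x : ℝ => -x - t / x) (-1 + t / x ^ 2) x := by
    refine ((hasDerivAt_id x).neg.sub
      ((hasDerivAt_const x t).div (hasDerivAt_id x) hx.ne')).congr_deriv ?_
    simp only [id]
    ring
  unfold pertLagWeight
  refine (h1.mul h2.exp).congr_deriv ?_
  rw [Real.rpow_sub hx β 2, Real.rpow_two]
  ring

/-- Integration by parts for the perturbed Laguerre weight. -/
lemma weightIntegral_recurrence (β : ℝ) {t : ℝ} (ht : 0 < t) :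
    β * weightIntegral (β - 1) t - weightIntegral β t + t * weightIntegral (β - 2) t = 0 := by
  set f : ℝ → ℝ := (Ioi (0:ℝ)).indicator (pertLagWeight β t) with hf
  have hfx : ∀ x, 0 < x → f x = pertLagWeight β t x := fun x hx => indicator_of_mem hx _
  have i0 := integrableOn_pertLagWeight β ht
  have i1 := integrableOn_pertLagWeight (β - 1) ht
  have i2 := integrableOn_pertLagWeight (β - 2) ht
  have hder : ∀ x ∈ Ioi (0:ℝ), HasDerivAt f
      (β * pertLagWeight (β - 1) t x - pertLagWeight β t x + t * pertLagWeight (β - 2) t x) x := by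
    intro x hx
    refine (hasDerivAt_pertLagWeight β t hx).congr_of_eventuallyEq ?_
    filter_upwards [Ioi_mem_nhds hx] with y hy using hfx y hy
  have hint : IntegrableOn (fun x =>
      β * pertLagWeight (β - 1) t x - pertLagWeight β t x + t * pertLagWeight (β - 2) t x)
      (Ioi 0) := ((i1.const_mul β).sub i0).add (i2.const_mul t)
  have htop : Tendsto f atTop (𝓝 0) :=
    tendsto_zero_of_hasDerivAt_of_integrableOn_Ioi hder hint
      (i0.congr_fun (fun x hx => (hfx x hx).symm) measurableSet_Ioi)
  have hcont : ContinuousWithinAt f (Ici 0) 0 := by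
    obtain ⟨k, hk⟩ := exists_nat_gt (-β)
    have h0 : f 0 = 0 := by simp [hf]
    have hpos : 0 < β + k := by linarith
    unfold ContinuousWithinAt
    rw [h0]
    have hg : Tendsto (fun x : ℝ => (k.factorial / t ^ k) * (Real.exp (-x) * x ^ (β + k)))
        (𝓝[Ici 0] 0) (𝓝 0) := by
      have : ContinuousAt
          (fun x : ℝ => (k.factorial / t ^ k) * (Real.exp (-x) * x ^ (β + k))) 0 :=
        continuousAt_const.mul ((by fun_prop : ContinuousAt (fun x : ℝ => Real.exp (-x)) 0).mul
          (Real.continuousAt_rpow_const 0 _ (Or.inr hpos.le)))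
      have h := this.tendsto
      simp only [Real.zero_rpow hpos.ne', mul_zero] at h
      exact h.mono_left nhdsWithin_le_nhds
    refine tendsto_of_tendsto_of_tendsto_of_le_of_le' tendsto_const_nhds hg
      (Eventually.of_forall fun x => indicator_nonneg (fun y hy => (pertLagWeight_pos β t hy).le) x)
      ?_
    filter_upwards [self_mem_nhdsWithin] with x hx
    rcases eq_or_lt_of_le (show (0:ℝ) ≤ x from hx) with h | h
    · rw [← h, h0]
      simp [Real.zero_rpow hpos.ne']
    · rw [hfx x h]
      exact pertLagWeight_le β ht k h
  have h := integral_Ioi_of_hasDerivAt_of_tendsto hcont hder hint htop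
  have h' := integral_add ((i1.const_mul β).sub i0) (i2.const_mul t)
  simp only [Pi.sub_apply] at h'
  rw [h', integral_sub (i1.const_mul β) i0, integral_const_mul, integral_const_mul] at h
  simpa [weightIntegral, hf] using h

section

open Polynomial

/-- The functional `p ↦ ∫_0^∞ p(x) x^b e^{-x - t/x} dx` on polynomials. -/
noncomputable def weightFunctional (b t : ℝ) : ℝ[X] →ₗ[ℝ] ℝ :=
  Polynomial.lsum fun k => LinearMap.toSpanSingleton ℝ ℝ (weightIntegral (b + k) t)

lemma weightFunctional_monomial (b t : ℝ) (k : ℕ) (a : ℝ) :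
    weightFunctional b t (monomial k a) = a * weightIntegral (b + k) t := by
  simp [weightFunctional, Polynomial.lsum_apply, Polynomial.sum_monomial_index]

lemma weightFunctional_eq_sum_range (b t : ℝ) {p : ℝ[X]} {N : ℕ} (hp : ∀ i, N ≤ i → p.coeff i = 0) :
    weightFunctional b t p = ∑ i ∈ Finset.range N, p.coeff i * weightIntegral (b + i) t := by
  have h : p = ∑ i ∈ Finset.range N, monomial i (p.coeff i) := by
    ext m
    simp only [finsetSum_coeff, coeff_monomial, Finset.sum_ite_eq', Finset.mem_range]
    split_ifs with hm
    · rfl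
    · exact hp m (not_lt.mp hm)
  conv_lhs => rw [h]
  simp only [map_sum, weightFunctional_monomial]

lemma weightFunctional_X_mul (b t : ℝ) (p : ℝ[X]) :
    weightFunctional b t (X * p) = weightFunctional (b + 1) t p := by
  induction p using Polynomial.induction_on' with
  | add p q hp hq => simp only [mul_add, map_add, hp, hq]
  | monomial k a =>
    rw [X_mul_monomial, weightFunctional_monomial, weightFunctional_monomial]
    push_cast
    ring_nf

lemma weightFunctional_C_mul (b t a : ℝ) (p : ℝ[X]) :
    weightFunctional b t (C a * p) = a * weightFunctional b t p := by
  rw [← smul_eq_C_mul, map_smul, smul_eq_mul]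

/-- Integration by parts for polynomial multiples of the weight. -/
lemma weightFunctional_derivative (b : ℝ) {t : ℝ} (ht : 0 < t) (p : ℝ[X]) :
    weightFunctional b t (derivative p) + b * weightFunctional (b - 1) t p
      - weightFunctional b t p + t * weightFunctional (b - 2) t p = 0 := by
  induction p using Polynomial.induction_on' with
  | add p q hp hq =>
    simp only [map_add]
    linear_combination hp + hq
  | monomial k a =>
    have h := weightIntegral_recurrence (b + k) ht
    have e1 : b - 1 + k = b + k - 1 := by ring
    have e2 : b - 2 + k = b + k - 2 := by ring
    rw [derivative_monomial]
    simp only [weightFunctional_monomial, e1, e2]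
    rcases k with _ | k
    · simp only [Nat.cast_zero, mul_zero, zero_mul, add_zero] at h ⊢
      linear_combination a * h
    · have e3 : b + ((k + 1 : ℕ) : ℝ) - 1 = b + k := by push_cast; ring
      rw [e3] at h ⊢
      simp only [Nat.add_sub_cancel]
      push_cast at h ⊢
      linear_combination a * h

lemma weightFunctional_eq_integral (b : ℝ) {t : ℝ} (ht : 0 < t) (p : ℝ[X]) :
    IntegrableOn (fun x => p.eval x * pertLagWeight b t x) (Ioi 0) ∧
      weightFunctional b t p = ∫ x in Ioi (0:ℝ), p.eval x * pertLagWeight b t x := by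
  induction p using Polynomial.induction_on' with
  | add p q hp hq =>
    simp only [eval_add, add_mul, map_add]
    exact ⟨hp.1.add hq.1, by rw [hp.2, hq.2, integral_add hp.1 hq.1]⟩
  | monomial k a =>
    have h : ∀ x ∈ Ioi (0:ℝ), a * pertLagWeight (b + k) t x
        = (monomial k a).eval x * pertLagWeight b t x := fun x hx => by
      rw [← pow_mul_pertLagWeight b t k hx, eval_monomial, mul_assoc]
    refine ⟨IntegrableOn.congr_fun ((integrableOn_pertLagWeight (b + k) ht).const_mul a) h
      measurableSet_Ioi, ?_⟩
    rw [← setIntegral_congr_fun measurableSet_Ioi h, integral_const_mul, weightFunctional_monomial]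
    rfl

lemma weightFunctional_sq_nonneg (b : ℝ) {t : ℝ} (ht : 0 < t) (p : ℝ[X]) :
    0 ≤ weightFunctional b t (p * p) := by
  rw [(weightFunctional_eq_integral b ht _).2]
  refine setIntegral_nonneg measurableSet_Ioi fun x hx => ?_
  rw [eval_mul]
  exact mul_nonneg (mul_self_nonneg _) (pertLagWeight_pos b t hx).le

lemma weightFunctional_sq_pos (b : ℝ) {t : ℝ} (ht : 0 < t) {p : ℝ[X]} (hp : p ≠ 0) :
    0 < weightFunctional b t (p * p) := by
  obtain ⟨hi, he⟩ := weightFunctional_eq_integral b ht (p * p)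
  have hnn : ∀ᵐ x ∂volume.restrict (Ioi (0:ℝ)), 0 ≤ (p * p).eval x * pertLagWeight b t x := by
    filter_upwards [ae_restrict_mem measurableSet_Ioi] with x hx
    rw [eval_mul]
    exact mul_nonneg (mul_self_nonneg _) (pertLagWeight_pos b t hx).le
  rw [he, setIntegral_pos_iff_support_of_nonneg_ae hnn hi]
  have hsub : Ioi (0:ℝ) \ p.rootSet ℝ ⊆
      (Function.support fun x => (p * p).eval x * pertLagWeight b t x) ∩ Ioi 0 := by
    rintro x ⟨hx, hr⟩
    refine ⟨?_, hx⟩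
    have hne : p.eval x ≠ 0 := fun h0 => hr (by
      rw [mem_rootSet_of_ne hp]
      simpa using h0)
    rw [Function.mem_support, eval_mul]
    exact mul_ne_zero (mul_ne_zero hne hne) (pertLagWeight_pos b t hx).ne'
  refine lt_of_lt_of_le ?_ (measure_mono hsub)
  rw [measure_sdiff_null ((rootSet_finite p ℝ).measure_zero _)]
  simp

/-- `P` is the monic orthogonal polynomial of degree `n` for the perturbed Laguerre weight and `k`
represents evaluation at `0` on the polynomials of degree less than `n`. -/
structure IsOrthoPair (α t : ℝ) (n : ℕ) (P k : ℝ[X]) : Prop where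
  coeff_top : P.coeff n = 1
  coeff_high : ∀ i, n < i → P.coeff i = 0
  orth : ∀ q : ℝ[X], (∀ i, n ≤ i → q.coeff i = 0) → weightFunctional α t (P * q) = 0
  kernel_high : ∀ i, n ≤ i → k.coeff i = 0
  repro : ∀ q : ℝ[X], (∀ i, n ≤ i → q.coeff i = 0) → weightFunctional α t (k * q) = q.coeff 0

namespace IsOrthoPair

variable {α t : ℝ} {n : ℕ} {P k : ℝ[X]}

lemma ne_zero (H : IsOrthoPair α t n P k) : P ≠ 0 := by
  rintro rfl
  simpa using H.coeff_top

lemma functional_mul_div (H : IsOrthoPair α t n P k) {q : ℝ[X]} (hq : ∀ i, n < i → q.coeff i = 0) :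
    weightFunctional (α - 1) t (P * q) = q.coeff 0 * weightFunctional (α - 1) t P := by
  have e : P * q = C (q.coeff 0) * P + X * (P * divX q) := by
    conv_lhs => rw [← divX_mul_X_add q]
    ring
  rw [e, map_add, weightFunctional_C_mul, weightFunctional_X_mul, sub_add_cancel, H.orth, add_zero]
  intro i hi
  rw [coeff_divX]
  exact hq _ (by lia)

lemma functional_sq_div_sq (H : IsOrthoPair α t n P k) :
    weightFunctional (α - 2) t (P * P) = P.coeff 0 * weightFunctional (α - 2) t P
      + P.coeff 1 * weightFunctional (α - 1) t P := by
  have e : P * P = C (P.coeff 0) * P + X * (P * divX P) := by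
    conv_lhs => rhs; rw [← divX_mul_X_add P]
    ring
  have e' : α - 2 + 1 = α - 1 := by ring
  rw [e, map_add, weightFunctional_C_mul, weightFunctional_X_mul, e', H.functional_mul_div]
  · rw [coeff_divX]
  · intro i hi
    rw [coeff_divX]
    exact H.coeff_high _ (by lia)

lemma functional_kernel_div (H : IsOrthoPair α t n P k) :
    P.coeff 0 * weightFunctional (α - 1) t k + P.coeff 1
      = k.coeff 0 * weightFunctional (α - 1) t P := by
  rw [← H.functional_mul_div (fun i hi => H.kernel_high i hi.le)]
  have e : P * k = C (P.coeff 0) * k + X * (k * divX P) := by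
    conv_lhs => rw [← divX_mul_X_add P]
    ring
  rw [e, map_add, weightFunctional_C_mul, weightFunctional_X_mul, sub_add_cancel, H.repro,
    coeff_divX]
  intro i hi
  rw [coeff_divX]
  exact H.coeff_high _ (by lia)

lemma coeff_X_mul_derivative (p : ℝ[X]) (i : ℕ) :
    (X * derivative p).coeff i = i * p.coeff i := by
  rcases i with _ | i
  · simp
  · rw [coeff_X_mul, coeff_derivative]
    push_cast
    ring

lemma functional_kernel_mul (H : IsOrthoPair α t n P k) {q : ℝ[X]}
    (hq : ∀ i, n < i → q.coeff i = 0) :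
    weightFunctional α t (k * q) = q.coeff 0 - q.coeff n * P.coeff 0 := by
  have e : k * q = C (q.coeff n) * (P * k) + k * (q - C (q.coeff n) * P) := by ring
  rw [e, map_add, weightFunctional_C_mul, H.orth _ H.kernel_high, H.repro]
  · simp
  · intro i hi
    rw [coeff_sub, coeff_C_mul]
    rcases hi.eq_or_lt with rfl | hi
    · rw [H.coeff_top]; ring
    · rw [H.coeff_high i hi, hq i hi]; ring

lemma functional_mul (H : IsOrthoPair α t n P k) {q : ℝ[X]}
    (hq : ∀ i, n < i → q.coeff i = 0) :
    weightFunctional α t (P * q) = q.coeff n * weightFunctional α t (P * P) := by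
  have e : P * q = C (q.coeff n) * (P * P) + P * (q - C (q.coeff n) * P) := by ring
  rw [e, map_add, weightFunctional_C_mul, H.orth (q - C (q.coeff n) * P), add_zero]
  intro i hi
  rw [coeff_sub, coeff_C_mul]
  rcases hi.eq_or_lt with rfl | hi
  · rw [H.coeff_top]; ring
  · rw [H.coeff_high i hi, hq i hi]; ring

lemma functional_sq_div (H : IsOrthoPair α t n P k) :
    weightFunctional (α - 1) t (P * P) = P.coeff 0 * weightFunctional (α - 1) t P :=
  H.functional_mul_div H.coeff_high

lemma coeff_zero_mul_pos (H : IsOrthoPair α t n P k) (ht : 0 < t) :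
    0 < P.coeff 0 * weightFunctional (α - 1) t P := by
  rw [← H.functional_sq_div]
  exact weightFunctional_sq_pos _ ht H.ne_zero

/-- Integration by parts applied to `P²`. -/
lemma norm_identity (H : IsOrthoPair α t n P k) (ht : 0 < t) :
    α * (P.coeff 0 * weightFunctional (α - 1) t P) - weightFunctional α t (P * P)
      + t * weightFunctional (α - 2) t (P * P) = 0 := by
  have h := weightFunctional_derivative α ht (P * P)
  have h0 : weightFunctional α t (derivative (P * P)) = 0 := by
    have : derivative (P * P) = P * derivative P + P * derivative P := by
      rw [derivative_mul]; ring
    rw [this, map_add, H.orth, add_zero]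
    intro i hi
    rw [coeff_derivative, H.coeff_high _ (by lia), zero_mul]
  rw [h0, H.functional_sq_div] at h
  linarith

/-- Integration by parts applied to `X k²`. -/
lemma kernel_identity (H : IsOrthoPair α t n P k) (ht : 0 < t) :
    (1 + α) * k.coeff 0 + (X * k).coeff n * P.coeff 0
      + t * weightFunctional (α - 1) t (k * k) = 0 := by
  have h := weightFunctional_derivative α ht (X * (k * k))
  have hd : derivative (X * (k * k))
      = k * k + (k * (X * derivative k) + k * (X * derivative k)) := by
    simp only [derivative_mul, derivative_X]; ring
  have hxk : ∀ i, n ≤ i → (X * derivative k).coeff i = 0 := fun i hi => by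
    rw [coeff_X_mul_derivative, H.kernel_high i hi, mul_zero]
  have e1 : α - 2 + 1 = α - 1 := by ring
  have hX : weightFunctional α t (X * (k * k)) = -((X * k).coeff n * P.coeff 0) := by
    have : X * (k * k) = k * (X * k) := by ring
    rw [this, H.functional_kernel_mul]
    · simp
    · intro i hi
      obtain ⟨j, rfl⟩ : ∃ j, i = j + 1 := ⟨i - 1, by lia⟩
      rw [coeff_X_mul, H.kernel_high j (by lia)]
  rw [hd, map_add, map_add, H.repro _ H.kernel_high, H.repro _ hxk, coeff_X_mul_derivative, hX,
    weightFunctional_X_mul, weightFunctional_X_mul, sub_add_cancel, e1,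
    H.repro _ H.kernel_high] at h
  push_cast at h
  linarith

/-- Integration by parts applied to `X k P`. -/
lemma mixed_identity (H : IsOrthoPair α t n P k) (ht : 0 < t) :
    t * (k.coeff 0 * weightFunctional (α - 1) t P)
      = n * P.coeff 0 + (X * k).coeff n * weightFunctional α t (P * P) := by
  have h := weightFunctional_derivative α ht (X * (P * k))
  have hd : derivative (X * (P * k))
      = P * k + (k * (X * derivative P) + P * (X * derivative k)) := by
    simp only [derivative_mul, derivative_X]; ring
  have hxk : ∀ i, n ≤ i → (X * derivative k).coeff i = 0 := fun i hi => by
    rw [coeff_X_mul_derivative, H.kernel_high i hi, mul_zero]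
  have hxP : ∀ i, n < i → (X * derivative P).coeff i = 0 := fun i hi => by
    rw [coeff_X_mul_derivative, H.coeff_high i hi, mul_zero]
  have e1 : α - 2 + 1 = α - 1 := by ring
  have hX : weightFunctional α t (X * (P * k))
      = (X * k).coeff n * weightFunctional α t (P * P) := by
    have : X * (P * k) = P * (X * k) := by ring
    rw [this, H.functional_mul]
    intro i hi
    obtain ⟨j, rfl⟩ : ∃ j, i = j + 1 := ⟨i - 1, by lia⟩
    rw [coeff_X_mul, H.kernel_high j (by lia)]
  rw [hd, map_add, map_add, H.orth _ H.kernel_high, H.functional_kernel_mul hxP, H.orth _ hxk,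
    coeff_X_mul_derivative, coeff_X_mul_derivative, H.coeff_top, hX, weightFunctional_X_mul,
    weightFunctional_X_mul, sub_add_cancel, e1, H.orth _ H.kernel_high,
    H.functional_mul_div (fun i hi => H.kernel_high i hi.le)] at h
  push_cast at h
  linarith

/-- The mean of `1/x` against `P² w` is at most `1/α`. -/
lemma mean_inv_le (H : IsOrthoPair α t n P k) (ht : 0 < t) :
    α * (P.coeff 0 * weightFunctional (α - 1) t P) ≤ weightFunctional α t (P * P) := by
  have h := H.norm_identity ht
  have := mul_nonneg ht.le (weightFunctional_sq_nonneg (α - 2) ht P)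
  linarith

/-- The mean of `x` against `P² w` is at least the reciprocal of the mean of `1/x`. -/
lemma le_mean_inv_mul (H : IsOrthoPair α t n P k) (ht : 0 < t) :
    weightFunctional α t (P * P) ^ 2 ≤ (P.coeff 0 * weightFunctional (α - 1) t P) *
      ((2 * n + 1 + α) * weightFunctional α t (P * P)
        + t * (P.coeff 0 * weightFunctional (α - 1) t P)) := by
  have h := weightFunctional_derivative α ht (X * (P * P))
  have hd : derivative (X * (P * P))
      = P * P + (P * (X * derivative P) + P * (X * derivative P)) := by
    simp only [derivative_mul, derivative_X]; ring
  have hxP : ∀ i, n < i → (X * derivative P).coeff i = 0 := fun i hi => by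
    rw [coeff_X_mul_derivative, H.coeff_high i hi, mul_zero]
  have e1 : α - 2 + 1 = α - 1 := by ring
  rw [hd, map_add, map_add, H.functional_mul hxP, coeff_X_mul_derivative, H.coeff_top,
    weightFunctional_X_mul (α - 1), weightFunctional_X_mul (α - 2), sub_add_cancel, e1,
    H.functional_sq_div] at h
  have hp := H.coeff_zero_mul_pos ht
  set c := P.coeff 0 * weightFunctional (α - 1) t P with hc
  set h0 := weightFunctional α t (P * P) with hh0
  have hs := weightFunctional_sq_nonneg (α - 1) ht ((C c * X - C h0) * P)
  have e : (C c * X - C h0) * P * ((C c * X - C h0) * P)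
      = C (c ^ 2) * (X * (X * (P * P))) - C (2 * c * h0) * (X * (P * P))
        + C (h0 ^ 2) * (P * P) := by
    simp only [C_mul, C_pow, C_ofNat]
    ring
  rw [e, map_add, map_sub, weightFunctional_C_mul, weightFunctional_C_mul, weightFunctional_C_mul,
    weightFunctional_X_mul (α - 1), weightFunctional_X_mul (α - 1), sub_add_cancel,
    H.functional_sq_div, ← hc, ← hh0] at hs
  have hx : weightFunctional α t (X * (P * P)) = (2 * n + 1 + α) * h0 + t * c := by
    linarith
  rw [hx] at hs
  have : c * h0 ^ 2 ≤ c * (c * ((2 * n + 1 + α) * h0 + t * c)) := by nlinarith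
  exact le_of_mul_le_mul_left this hp

end IsOrthoPair

/-- Coefficientwise differentiability at `t` of a family of polynomials of bounded degree. -/
def HasCoeffDerivAt (p : ℝ → ℝ[X]) (p' : ℝ[X]) (t : ℝ) : Prop :=
  (∃ N : ℕ, ∀ᶠ τ in 𝓝 t, ∀ i, N ≤ i → (p τ).coeff i = 0) ∧
    ∀ i, HasDerivAt (fun τ => (p τ).coeff i) (p'.coeff i) t

namespace HasCoeffDerivAt

variable {p q : ℝ → ℝ[X]} {p' q' : ℝ[X]} {t : ℝ}

lemma coeff_eq_zero (hp : HasCoeffDerivAt p p' t) {i : ℕ} {c : ℝ}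
    (h : ∀ᶠ τ in 𝓝 t, (p τ).coeff i = c) : p'.coeff i = 0 :=
  (hp.2 i).unique ((hasDerivAt_const t c).congr_of_eventuallyEq h)

lemma mul (hp : HasCoeffDerivAt p p' t) (hq : HasCoeffDerivAt q q' t) :
    HasCoeffDerivAt (fun τ => p τ * q τ) (p' * q t + p t * q') t := by
  refine ⟨?_, fun i => ?_⟩
  · obtain ⟨N, hN⟩ := hp.1
    obtain ⟨M, hM⟩ := hq.1
    refine ⟨N + M, ?_⟩
    filter_upwards [hN, hM] with τ h1 h2 i hi
    rw [coeff_mul]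
    refine Finset.sum_eq_zero fun x hx => ?_
    have hx := Finset.HasAntidiagonal.mem_antidiagonal.1 hx
    rcases le_or_gt N x.1 with h | h
    · rw [h1 _ h, zero_mul]
    · rw [h2 _ (by lia), mul_zero]
  · simp only [coeff_mul, coeff_add, ← Finset.sum_add_distrib]
    exact HasDerivAt.fun_sum fun x _ => (hp.2 x.1).mul (hq.2 x.2)

lemma const (p : ℝ[X]) (t : ℝ) : HasCoeffDerivAt (fun _ => p) 0 t :=
  ⟨⟨p.natDegree + 1, Eventually.of_forall fun _ i hi =>
    coeff_eq_zero_of_natDegree_lt (by lia)⟩, fun i => by simpa using hasDerivAt_const t (p.coeff i)⟩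

lemma hasDerivAt_functional (hp : HasCoeffDerivAt p p' t) (b : ℝ) (ht : 0 < t) :
    HasDerivAt (fun τ => weightFunctional b τ (p τ))
      (weightFunctional b t p' - weightFunctional (b - 1) t (p t)) t := by
  obtain ⟨N, hN⟩ := hp.1
  have h' : ∀ i, N ≤ i → p'.coeff i = 0 := fun i hi =>
    hp.coeff_eq_zero (hN.mono fun τ h => h i hi)
  have hsum : HasDerivAt (fun τ => ∑ i ∈ Finset.range N, (p τ).coeff i * weightIntegral (b + i) τ)
      (∑ i ∈ Finset.range N, (p'.coeff i * weightIntegral (b + i) t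
        + (p t).coeff i * -weightIntegral (b + i - 1) t)) t :=
    HasDerivAt.fun_sum fun i _ => (hp.2 i).mul (hasDerivAt_weightIntegral (b + i) ht)
  have hd := hsum.congr_of_eventuallyEq
    (hN.mono fun τ h => weightFunctional_eq_sum_range b τ h)
  refine hd.congr_deriv ?_
  rw [weightFunctional_eq_sum_range b t h', weightFunctional_eq_sum_range (b - 1) t hN.self_of_nhds,
    ← Finset.sum_sub_distrib]
  refine Finset.sum_congr rfl fun i _ => ?_
  rw [show b - 1 + (i : ℝ) = b + i - 1 by ring]
  ring

end HasCoeffDerivAt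

/-- The mean of `1/x` against `P² w`, for the orthogonal polynomial `P`. -/
noncomputable def invMean (α t : ℝ) (P : ℝ[X]) : ℝ :=
  P.coeff 0 * weightFunctional (α - 1) t P / weightFunctional α t (P * P)

section deformation

variable {α t : ℝ} {n : ℕ} {P k : ℝ → ℝ[X]} {P' k' : ℝ[X]}

lemma coeff_deriv_high (hH : ∀ τ > 0, IsOrthoPair α τ n (P τ) (k τ)) (ht : 0 < t)
    (hP : HasCoeffDerivAt P P' t) {i : ℕ} (hi : n ≤ i) : P'.coeff i = 0 := by
  rcases hi.eq_or_lt with rfl | hi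
  · exact hP.coeff_eq_zero ((lt_mem_nhds ht).mono fun τ h => (hH τ h).coeff_top)
  · exact hP.coeff_eq_zero ((lt_mem_nhds ht).mono fun τ h => (hH τ h).coeff_high i hi)

lemma deformation_polynomial (hH : ∀ τ > 0, IsOrthoPair α τ n (P τ) (k τ)) (ht : 0 < t)
    (hP : HasCoeffDerivAt P P' t) :
    P' = C (weightFunctional (α - 1) t (P t)) * k t := by
  set ρ := weightFunctional (α - 1) t (P t) with hρ
  have hdeg : ∀ i, n ≤ i → (P' - C ρ * k t).coeff i = 0 := fun i hi => by
    rw [coeff_sub, coeff_C_mul, coeff_deriv_high hH ht hP hi, (hH t ht).kernel_high i hi]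
    ring
  have horth : ∀ q : ℝ[X], (∀ i, n ≤ i → q.coeff i = 0) →
      weightFunctional α t ((P' - C ρ * k t) * q) = 0 := by
    intro q hq
    have h1 := (hP.mul (HasCoeffDerivAt.const q t)).hasDerivAt_functional α ht
    have h2 : HasDerivAt (fun τ => weightFunctional α τ (P τ * q)) 0 t :=
      (hasDerivAt_const t (0:ℝ)).congr_of_eventuallyEq
        ((lt_mem_nhds ht).mono fun τ h => (hH τ h).orth q hq)
    have h3 := h1.unique h2
    rw [mul_zero, add_zero, (hH t ht).functional_mul_div (fun i hi => hq i hi.le)] at h3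
    rw [sub_mul, map_sub, mul_assoc, weightFunctional_C_mul, (hH t ht).repro q hq]
    linarith
  by_contra hne
  have hpos := weightFunctional_sq_pos α ht (sub_ne_zero.mpr hne)
  rw [horth _ hdeg] at hpos
  exact lt_irrefl _ hpos

lemma hasDerivAt_norm (hH : ∀ τ > 0, IsOrthoPair α τ n (P τ) (k τ)) (ht : 0 < t)
    (hP : HasCoeffDerivAt P P' t) :
    HasDerivAt (fun τ => weightFunctional α τ (P τ * P τ))
      (-((P t).coeff 0 * weightFunctional (α - 1) t (P t))) t := by
  refine ((hP.mul hP).hasDerivAt_functional α ht).congr_deriv ?_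
  rw [map_add, mul_comm P', (hH t ht).orth _ (fun i => coeff_deriv_high hH ht hP),
    (hH t ht).functional_sq_div]
  ring

lemma hasDerivAt_kernel (hH : ∀ τ > 0, IsOrthoPair α τ n (P τ) (k τ)) (ht : 0 < t)
    (hk : HasCoeffDerivAt k k' t) :
    HasDerivAt (fun τ => (k τ).coeff 0) (weightFunctional (α - 1) t (k t * k t)) t := by
  have hdeg : ∀ i, n ≤ i → k'.coeff i = 0 := fun i hi =>
    hk.coeff_eq_zero ((lt_mem_nhds ht).mono fun τ h => (hH τ h).kernel_high i hi)
  have h1 := (hk.mul hk).hasDerivAt_functional α ht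
  rw [map_add, mul_comm k', (hH t ht).repro _ hdeg] at h1
  have h2 := (hk.2 0).congr_of_eventuallyEq
    ((lt_mem_nhds ht).mono fun τ h => (hH τ h).repro _ (hH τ h).kernel_high)
  have h3 := h1.unique h2
  refine (hk.2 0).congr_deriv ?_
  linarith

lemma hasDerivAt_functional_inv (hH : ∀ τ > 0, IsOrthoPair α τ n (P τ) (k τ)) (ht : 0 < t)
    (hP : HasCoeffDerivAt P P' t) :
    HasDerivAt (fun τ => weightFunctional (α - 1) τ (P τ))
      (weightFunctional (α - 1) t (P t) * weightFunctional (α - 1) t (k t)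
        - weightFunctional (α - 2) t (P t)) t := by
  refine (hP.hasDerivAt_functional (α - 1) ht).congr_deriv ?_
  rw [deformation_polynomial hH ht hP, weightFunctional_C_mul, show α - 1 - 1 = α - 2 by ring]

lemma hasDerivAt_coeff_zero (hH : ∀ τ > 0, IsOrthoPair α τ n (P τ) (k τ)) (ht : 0 < t)
    (hP : HasCoeffDerivAt P P' t) :
    HasDerivAt (fun τ => (P τ).coeff 0)
      (weightFunctional (α - 1) t (P t) * (k t).coeff 0) t := by
  refine (hP.2 0).congr_deriv ?_
  rw [deformation_polynomial hH ht hP, coeff_C_mul]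

/-- The companion `t (∂_t P)(0) / P(0)` of `invMean` in the Painlevé III system. -/
noncomputable def logDerivAtZero (α t : ℝ) (P k : ℝ[X]) : ℝ :=
  t * weightFunctional (α - 1) t P * k.coeff 0 / P.coeff 0

lemma hasDerivAt_invMean (hH : ∀ τ > 0, IsOrthoPair α τ n (P τ) (k τ)) (ht : 0 < t)
    (hP : HasCoeffDerivAt P P' t) :
    HasDerivAt (fun τ => invMean α τ (P τ))
      (invMean α t (P t) / t * (2 * logDerivAtZero α t (P t) (k t) + α + t * invMean α t (P t)
        - 1 / invMean α t (P t))) t := by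
  have Ht := hH t ht
  have hpos := Ht.coeff_zero_mul_pos ht
  have hh := weightFunctional_sq_pos α ht Ht.ne_zero
  have h1 := Ht.norm_identity ht
  have h2 := Ht.functional_sq_div_sq
  have h3 := Ht.functional_kernel_div
  have hd := ((hasDerivAt_coeff_zero hH ht hP).mul (hasDerivAt_functional_inv hH ht hP)).div
    (hasDerivAt_norm hH ht hP) hh.ne'
  refine hd.congr_deriv ?_
  simp only [invMean, logDerivAtZero, Pi.mul_apply]
  rw [h2] at h1
  generalize weightFunctional α t (P t * P t) = h at *
  generalize weightFunctional (α - 1) t (P t) = ρ at *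
  generalize weightFunctional (α - 2) t (P t) = σ at *
  generalize weightFunctional (α - 1) t (k t) = κ at *
  generalize (P t).coeff 0 = π at *
  generalize (P t).coeff 1 = π₁ at *
  generalize (k t).coeff 0 = K at *
  have hπ : π ≠ 0 := left_ne_zero_of_mul hpos.ne'
  have hρ : ρ ≠ 0 := right_ne_zero_of_mul hpos.ne'
  have hh' := hh.ne'
  have ht' := ht.ne'
  field_simp
  linear_combination (t * h * ρ) * h3 - h * h1

lemma hasDerivAt_logDerivAtZero (hH : ∀ τ > 0, IsOrthoPair α τ n (P τ) (k τ)) (ht : 0 < t)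
    (hP : HasCoeffDerivAt P P' t) (hk : HasCoeffDerivAt k k' t) :
    HasDerivAt (fun τ => logDerivAtZero α τ (P τ) (k τ))
      (-invMean α t (P t) * (logDerivAtZero α t (P t) (k t) - n)
        - logDerivAtZero α t (P t) (k t) / (t * invMean α t (P t))) t := by
  have Ht := hH t ht
  have hpos := Ht.coeff_zero_mul_pos ht
  have hπ : (P t).coeff 0 ≠ 0 := left_ne_zero_of_mul hpos.ne'
  have hh := weightFunctional_sq_pos α ht Ht.ne_zero
  have h1 := Ht.norm_identity ht
  have h2 := Ht.functional_sq_div_sq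
  have h3 := Ht.functional_kernel_div
  have h4 := Ht.kernel_identity ht
  have h5 := Ht.mixed_identity ht
  have hd := (((hasDerivAt_id t).mul (hasDerivAt_functional_inv hH ht hP)).mul
    (hasDerivAt_kernel hH ht hk)).div (hasDerivAt_coeff_zero hH ht hP) hπ
  refine hd.congr_deriv ?_
  simp only [invMean, logDerivAtZero, Pi.mul_apply, id]
  rw [h2] at h1
  generalize weightFunctional α t (P t * P t) = h at *
  generalize weightFunctional (α - 1) t (P t) = ρ at *
  generalize weightFunctional (α - 2) t (P t) = σ at *
  generalize weightFunctional (α - 1) t (k t) = κ at *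
  generalize weightFunctional (α - 1) t (k t * k t) = K' at *
  generalize (X * k t).coeff n = l at *
  generalize (P t).coeff 0 = π at *
  generalize (P t).coeff 1 = π₁ at *
  generalize (k t).coeff 0 = K at *
  have hρ : ρ ≠ 0 := right_ne_zero_of_mul hpos.ne'
  have hh' := hh.ne'
  have ht' := ht.ne'
  field_simp
  linear_combination (K * h * t * ρ) * h3 - (K * h) * h1 + h * ρ * π * h4 + π ^ 2 * ρ * h5

end deformation

namespace HasCoeffDerivAt

variable {p q : ℝ → ℝ[X]} {p' q' : ℝ[X]} {t : ℝ}

lemma add (hp : HasCoeffDerivAt p p' t) (hq : HasCoeffDerivAt q q' t) :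
    HasCoeffDerivAt (fun τ => p τ + q τ) (p' + q') t := by
  refine ⟨?_, fun i => ?_⟩
  · obtain ⟨N, hN⟩ := hp.1
    obtain ⟨M, hM⟩ := hq.1
    refine ⟨N + M, ?_⟩
    filter_upwards [hN, hM] with τ h1 h2 i hi
    rw [coeff_add, h1 _ (by lia), h2 _ (by lia), add_zero]
  · simp only [coeff_add]
    exact (hp.2 i).add (hq.2 i)

lemma scalar {a : ℝ → ℝ} {a' : ℝ} (ha : HasDerivAt a a' t) :
    HasCoeffDerivAt (fun τ => C (a τ)) (C a') t := by
  refine ⟨⟨1, Eventually.of_forall fun τ i hi => by rw [coeff_C, if_neg (by lia)]⟩, fun i => ?_⟩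
  simp only [coeff_C]
  split_ifs
  · exact ha
  · exact hasDerivAt_const t 0

end HasCoeffDerivAt

/-- The monic orthogonal polynomial `P_n`, the representer of `q ↦ [x^{n-1}] q` and the representer
of `q ↦ q(0)` on polynomials of degree less than `n`, by the three-term recurrence. -/
noncomputable def orthoTriple (α t : ℝ) : ℕ → ℝ[X] × ℝ[X] × ℝ[X]
  | 0 => (1, 0, 0)
  | n + 1 =>
    let P := (orthoTriple α t n).1
    let h := weightFunctional α t (P * P)
    (X * P + (C (-(weightFunctional α t (X * (P * P)) / h)) * P
      + C (-h) * (orthoTriple α t n).2.1),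
      C h⁻¹ * P, (orthoTriple α t n).2.2 + C (P.coeff 0 / h) * P)

/-- The monic orthogonal polynomials of the perturbed Laguerre weight. -/
noncomputable def orthoPoly (α : ℝ) (n : ℕ) (t : ℝ) : ℝ[X] := (orthoTriple α t n).1

/-- The reproducing kernel at `0` of the polynomials of degree less than `n`. -/
noncomputable def orthoKernel (α : ℝ) (n : ℕ) (t : ℝ) : ℝ[X] := (orthoTriple α t n).2.2

lemma orthoTriple_spec (α : ℝ) {t : ℝ} (ht : 0 < t) (n : ℕ) :
    IsOrthoPair α t n (orthoPoly α n t) (orthoKernel α n t) ∧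
      (∀ i, n ≤ i → (orthoTriple α t n).2.1.coeff i = 0) ∧
      ∀ q : ℝ[X], (∀ i, n ≤ i → q.coeff i = 0) →
        weightFunctional α t ((orthoTriple α t n).2.1 * q) = (X * q).coeff n := by
  induction n with
  | zero =>
    have hq0 : ∀ q : ℝ[X], (∀ i, 0 ≤ i → q.coeff i = 0) → q = 0 := fun q hq =>
      Polynomial.ext fun i => hq i (Nat.zero_le _)
    refine ⟨⟨by simp [orthoPoly, orthoTriple], fun i hi => ?_, fun q hq => by simp [hq0 q hq],
      fun i _ => by simp [orthoKernel, orthoTriple], fun q hq => by simp [hq0 q hq]⟩,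
      fun i _ => by simp [orthoTriple], fun q hq => by simp [hq0 q hq]⟩
    simp [orthoPoly, orthoTriple, coeff_one, hi.ne']
  | succ n ih =>
    obtain ⟨H, hl, hr⟩ := ih
    have hh := weightFunctional_sq_pos α ht H.ne_zero
    have eP : orthoPoly α (n + 1) t = X * orthoPoly α n t
        + (C (-(weightFunctional α t (X * (orthoPoly α n t * orthoPoly α n t))
          / weightFunctional α t (orthoPoly α n t * orthoPoly α n t))) * orthoPoly α n t
        + C (-weightFunctional α t (orthoPoly α n t * orthoPoly α n t))
          * (orthoTriple α t n).2.1) := rfl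
    have ek : orthoKernel α (n + 1) t = orthoKernel α n t
        + C ((orthoPoly α n t).coeff 0 / weightFunctional α t (orthoPoly α n t * orthoPoly α n t))
          * orthoPoly α n t := rfl
    have el : (orthoTriple α t (n + 1)).2.1
        = C (weightFunctional α t (orthoPoly α n t * orthoPoly α n t))⁻¹ * orthoPoly α n t := rfl
    generalize orthoPoly α n t = P at *
    generalize orthoKernel α n t = k at *
    generalize (orthoTriple α t n).2.1 = l at *
    have hh' := hh.ne'
    have hdec : ∀ q : ℝ[X], (∀ i, n + 1 ≤ i → q.coeff i = 0) →
        ∃ a : ℝ, ∃ u : ℝ[X], (∀ i, n ≤ i → u.coeff i = 0) ∧ q = C a * P + u ∧ a = q.coeff n := by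
      intro q hq
      refine ⟨q.coeff n, q - C (q.coeff n) * P, fun i hi => ?_, by ring, rfl⟩
      rcases hi.eq_or_lt with rfl | hi
      · rw [coeff_sub, coeff_C_mul, H.coeff_top]; ring
      · rw [coeff_sub, coeff_C_mul, H.coeff_high i hi, hq i hi]; ring
    rw [eP, ek, el]
    generalize hh0 : weightFunctional α t (P * P) = h at *
    generalize hx0 : weightFunctional α t (X * (P * P)) = x at *
    refine ⟨⟨?_, fun i hi => ?_, fun q hq => ?_, fun i hi => ?_, fun q hq => ?_⟩,
      fun i hi => ?_, fun q hq => ?_⟩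
    · simp [H.coeff_top, H.coeff_high (n + 1) (by lia), hl (n + 1) (by lia)]
    · obtain ⟨i, rfl⟩ := Nat.exists_eq_add_of_lt (Nat.zero_lt_of_lt hi)
      have e : 0 + i + 1 = i + 1 := by ring
      rw [e] at hi ⊢
      simp only [coeff_add, coeff_X_mul, coeff_C_mul, H.coeff_high i (by lia),
        H.coeff_high (i + 1) (by lia), hl (i + 1) (by lia)]
      ring
    · obtain ⟨a, u, hu, rfl, -⟩ := hdec q hq
      have e : (X * P + (C (-(x / h)) * P + C (-h) * l)) * (C a * P + u)
          = C a * (X * (P * P)) + C (-(x / h)) * (C a * (P * P)) + C (-h) * (C a * (P * l))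
            + P * (X * u) + C (-(x / h)) * (P * u) + C (-h) * (l * u) := by ring
      have hXu : ∀ i, n < i → (X * u).coeff i = 0 := fun i hi => by
        obtain ⟨i, rfl⟩ := Nat.exists_eq_add_of_lt (Nat.zero_lt_of_lt hi)
        rw [coeff_X_mul]
        exact hu _ (by lia)
      rw [e]
      simp only [map_add, weightFunctional_C_mul, H.orth l hl, H.orth u hu, hr u hu,
        H.functional_mul hXu, hh0, hx0]
      field_simp
      ring
    · simp [H.coeff_high i (by lia), H.kernel_high i (by lia)]
    · obtain ⟨a, u, hu, rfl, -⟩ := hdec q hq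
      have e : (k + C (P.coeff 0 / h) * P) * (C a * P + u)
          = C a * (P * k) + k * u + C (P.coeff 0 / h) * (C a * (P * P))
            + C (P.coeff 0 / h) * (P * u) := by ring
      rw [e]
      simp only [map_add, weightFunctional_C_mul, H.orth k H.kernel_high, H.orth u hu,
        H.repro u hu, hh0, coeff_add, coeff_C_mul]
      field_simp
      ring
    · simp [H.coeff_high i (by lia)]
    · obtain ⟨a, u, hu, rfl, ha⟩ := hdec q hq
      rw [mul_assoc, weightFunctional_C_mul, coeff_X_mul, ← ha, mul_add, mul_left_comm, map_add,
        weightFunctional_C_mul, hh0, H.orth u hu]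
      field_simp
      ring

lemma isOrthoPair_orthoPoly (α : ℝ) {t : ℝ} (ht : 0 < t) (n : ℕ) :
    IsOrthoPair α t n (orthoPoly α n t) (orthoKernel α n t) :=
  (orthoTriple_spec α ht n).1

lemma hasCoeffDerivAt_orthoTriple (α : ℝ) {t : ℝ} (ht : 0 < t) (n : ℕ) :
    (∃ P', HasCoeffDerivAt (orthoPoly α n) P' t) ∧
      (∃ l', HasCoeffDerivAt (fun τ => (orthoTriple α τ n).2.1) l' t) ∧
      ∃ k', HasCoeffDerivAt (orthoKernel α n) k' t := by
  induction n with
  | zero =>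
    exact ⟨⟨0, HasCoeffDerivAt.const 1 t⟩, ⟨0, HasCoeffDerivAt.const 0 t⟩,
      ⟨0, HasCoeffDerivAt.const 0 t⟩⟩
  | succ n ih =>
    obtain ⟨⟨P', hP⟩, ⟨l', hl⟩, ⟨k', hk⟩⟩ := ih
    have hX := HasCoeffDerivAt.const X t
    have hh := (hP.mul hP).hasDerivAt_functional α ht
    have hx := (hX.mul (hP.mul hP)).hasDerivAt_functional α ht
    have hh0 := (weightFunctional_sq_pos α ht (isOrthoPair_orthoPoly α ht n).ne_zero).ne'
    exact ⟨⟨_, (hX.mul hP).add (((HasCoeffDerivAt.scalar (hx.div hh hh0).neg).mul hP).add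
        ((HasCoeffDerivAt.scalar hh.neg).mul hl))⟩,
      ⟨_, (HasCoeffDerivAt.scalar (hh.inv hh0)).mul hP⟩,
      ⟨_, hk.add ((HasCoeffDerivAt.scalar ((hP.2 0).div hh hh0)).mul hP)⟩⟩

lemma hankelDet_succ (α : ℝ) {t : ℝ} (ht : 0 < t) (n : ℕ) :
    hankelDet α (n + 1) t
      = hankelDet α n t * weightFunctional α t (orthoPoly α n t * orthoPoly α n t) := by
  have H := isOrthoPair_orthoPoly α ht n
  generalize orthoPoly α n t = P at *
  set M : Matrix (Fin (n + 1)) (Fin (n + 1)) ℝ :=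
    Matrix.of (fun j k => pertLagMoment α t (j.1 + k.1)) with hM
  set c : Fin (n + 1) → ℝ := fun i => P.coeff i with hc
  have hMc : Matrix.mulVec M c = Pi.single (Fin.last n) (weightFunctional α t (P * P)) := by
    funext i
    have e1 : Matrix.mulVec M c i = weightFunctional α t (P * X ^ i.1) := by
      have hs : P * X ^ i.1 = ∑ j ∈ Finset.range (n + 1), monomial (i.1 + j) (P.coeff j) := by
        ext m
        rw [coeff_mul_X_pow', finsetSum_coeff]
        simp only [coeff_monomial]
        split_ifs with h
        · obtain ⟨m, rfl⟩ := Nat.exists_eq_add_of_le h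
          simp only [Nat.add_left_cancel_iff, Nat.add_sub_cancel_left, Finset.sum_ite_eq',
            Finset.mem_range]
          split_ifs with h2
          · rfl
          · exact H.coeff_high m (by lia)
        · exact (Finset.sum_eq_zero fun j _ => if_neg (by lia)).symm
      rw [hs, map_sum, ← Fin.sum_univ_eq_sum_range
        (fun j => weightFunctional α t (monomial (i.1 + j) (P.coeff j)))]
      simp only [Matrix.mulVec, dotProduct, hM, Matrix.of_apply, hc, weightFunctional_monomial,
        pertLagMoment_eq]
      exact Finset.sum_congr rfl fun j _ => mul_comm _ _
    rw [e1]
    have hdeg : ∀ j, n < j → (X ^ i.1 : ℝ[X]).coeff j = 0 := fun j hj => by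
      rw [coeff_X_pow, if_neg (by have := i.2; lia)]
    rw [H.functional_mul hdeg, coeff_X_pow, Pi.single_apply]
    by_cases hi : i = Fin.last n
    · subst hi; simp
    · have : n ≠ i.1 := fun h => hi (Fin.ext h.symm)
      simp [hi, this]
  have h2 := congrArg (fun v => Matrix.mulVec M.adjugate v (Fin.last n)) hMc
  simp only [Matrix.mulVec_mulVec, Matrix.adjugate_mul, Matrix.smul_mulVec, Matrix.one_mulVec,
    Matrix.mulVec_single, Pi.smul_apply, smul_eq_mul] at h2
  have h3 : c (Fin.last n) = 1 := by simp [hc, H.coeff_top]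
  have h4 : M.adjugate (Fin.last n) (Fin.last n) = hankelDet α n t := by
    rw [Matrix.adjugate_fin_succ_eq_det_submatrix, hankelDet]
    have e : (-1 : ℝ) ^ (((Fin.last n : Fin (n + 1)) : ℕ) + ((Fin.last n : Fin (n + 1)) : ℕ))
        = 1 := by
      rw [← two_mul, pow_mul]; simp
    rw [e, one_mul]
    congr 1
    ext i j
    simp [hM, Fin.succAbove_last]
  rw [h3, mul_one] at h2
  change M.det = _
  rw [h2, ← h4]
  simp [mul_comm]

lemma hankelDet_eq_prod (α : ℝ) {t : ℝ} (ht : 0 < t) (n : ℕ) :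
    hankelDet α n t
      = ∏ j ∈ Finset.range n, weightFunctional α t (orthoPoly α j t * orthoPoly α j t) := by
  induction n with
  | zero => simp [hankelDet]
  | succ n ih => rw [hankelDet_succ α ht, ih, Finset.prod_range_succ]

/-- The mean of `1/x` against `P_n² w`. -/
noncomputable def laguerreMean (α : ℝ) (n : ℕ) (t : ℝ) : ℝ := invMean α t (orthoPoly α n t)

lemma Hlog_eq_sum (α : ℝ) {t : ℝ} (ht : 0 < t) (n : ℕ) :
    Hlog α n t = -(t * ∑ j ∈ Finset.range n, laguerreMean α j t) := by
  have hpos : ∀ τ > 0, ∀ j, 0 < weightFunctional α τ (orthoPoly α j τ * orthoPoly α j τ) :=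
    fun τ h j => weightFunctional_sq_pos α h (isOrthoPair_orthoPoly α h j).ne_zero
  have hev : (fun τ => Real.log (hankelDet α n τ)) =ᶠ[𝓝 t] fun τ => ∑ j ∈ Finset.range n,
      Real.log (weightFunctional α τ (orthoPoly α j τ * orthoPoly α j τ)) := by
    filter_upwards [lt_mem_nhds ht] with τ h
    rw [hankelDet_eq_prod α h, Real.log_prod fun j _ => (hpos τ h j).ne']
  have hd : HasDerivAt (fun τ => ∑ j ∈ Finset.range n,
      Real.log (weightFunctional α τ (orthoPoly α j τ * orthoPoly α j τ)))
      (∑ j ∈ Finset.range n, -laguerreMean α j t) t := by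
    refine HasDerivAt.fun_sum fun j _ => ?_
    obtain ⟨⟨P', hP⟩, -, -⟩ := hasCoeffDerivAt_orthoTriple α ht j
    refine ((hasDerivAt_norm (fun τ h => isOrthoPair_orthoPoly α h j) ht hP).log
      (hpos t ht j).ne').congr_deriv ?_
    rw [laguerreMean, invMean, neg_div]
  rw [Hlog, (hd.congr_of_eventuallyEq hev).deriv, Finset.sum_neg_distrib]
  ring

/-- The companion of `laguerreMean` in the Painlevé III system. -/
noncomputable def laguerreLogDeriv (α : ℝ) (n : ℕ) (t : ℝ) : ℝ :=
  logDerivAtZero α t (orthoPoly α n t) (orthoKernel α n t)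

lemma hasDerivAt_laguerreMean (α : ℝ) {t : ℝ} (ht : 0 < t) (n : ℕ) :
    HasDerivAt (laguerreMean α n) (laguerreMean α n t / t * (2 * laguerreLogDeriv α n t + α
      + t * laguerreMean α n t - 1 / laguerreMean α n t)) t := by
  obtain ⟨⟨P', hP⟩, -, -⟩ := hasCoeffDerivAt_orthoTriple α ht n
  exact hasDerivAt_invMean (fun τ h => isOrthoPair_orthoPoly α h n) ht hP

lemma hasDerivAt_laguerreLogDeriv (α : ℝ) {t : ℝ} (ht : 0 < t) (n : ℕ) :
    HasDerivAt (laguerreLogDeriv α n) (-laguerreMean α n t * (laguerreLogDeriv α n t - n)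
      - laguerreLogDeriv α n t / (t * laguerreMean α n t)) t := by
  obtain ⟨⟨P', hP⟩, -, ⟨k', hk⟩⟩ := hasCoeffDerivAt_orthoTriple α ht n
  exact hasDerivAt_logDerivAtZero (fun τ h => isOrthoPair_orthoPoly α h n) ht hP hk

lemma laguerreMean_pos (α : ℝ) {t : ℝ} (ht : 0 < t) (n : ℕ) : 0 < laguerreMean α n t := by
  have H := isOrthoPair_orthoPoly α ht n
  exact div_pos (H.coeff_zero_mul_pos ht) (weightFunctional_sq_pos α ht H.ne_zero)

lemma mul_laguerreMean_le (α : ℝ) {t : ℝ} (ht : 0 < t) (n : ℕ) : α * laguerreMean α n t ≤ 1 := by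
  have H := isOrthoPair_orthoPoly α ht n
  rw [laguerreMean, invMean, ← mul_div_assoc, div_le_one (weightFunctional_sq_pos α ht H.ne_zero)]
  exact H.mean_inv_le ht

lemma inv_laguerreMean_le (α : ℝ) {t : ℝ} (ht : 0 < t) (n : ℕ) :
    1 / laguerreMean α n t ≤ 2 * n + 1 + α + t * laguerreMean α n t := by
  have H := isOrthoPair_orthoPoly α ht n
  have h := H.le_mean_inv_mul ht
  have hh := weightFunctional_sq_pos α ht H.ne_zero
  have hc := H.coeff_zero_mul_pos ht
  rw [laguerreMean, invMean, one_div_div]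
  generalize weightFunctional α t (orthoPoly α n t * orthoPoly α n t) = h0 at *
  generalize (orthoPoly α n t).coeff 0 * weightFunctional (α - 1) t (orthoPoly α n t) = c at *
  rw [div_le_iff₀ hc]
  have e : (2 * n + 1 + α + t * (c / h0)) * c = c * ((2 * n + 1 + α) * h0 + t * c) / h0 := by
    field_simp
  rw [e, le_div_iff₀ hh]
  linarith

end

/-- A maximum principle on the line for functions of at most linear growth. -/
lemma nonpos_of_le_secondDeriv {f f' f'' : ℝ → ℝ} {κ A B : ℝ} (hκ : 0 < κ)
    (hf : ∀ x, HasDerivAt f (f' x) x) (hf' : ∀ x, HasDerivAt f' (f'' x) x)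
    (hpos : ∀ x, 0 < f x → κ * f x ≤ f'' x) (hgrow : ∀ x, f x ≤ A + B * |x|) (x : ℝ) : f x ≤ 0 := by
  by_contra! hx
  have hψ : ∀ y : ℝ, 0 < 1 + κ / 2 * y ^ 2 := fun y => by positivity
  obtain ⟨δ, hδ, hδx⟩ : ∃ δ > 0, 0 < f x - δ * (1 + κ / 2 * x ^ 2) :=
    ⟨f x / (2 * (1 + κ / 2 * x ^ 2)), by have := hψ x; positivity, by
      have := hψ x
      field_simp
      linarith⟩
  set φ : ℝ → ℝ := fun y => f y - δ * (1 + κ / 2 * y ^ 2) with hφ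
  have h1 : ∀ y, HasDerivAt φ (f' y - δ * (κ * y)) y := fun y => by
    refine ((hf y).sub ((((hasDerivAt_pow 2 y).const_mul (κ / 2)).const_add 1).const_mul
      δ)).congr_deriv ?_
    push_cast
    ring
  have h2 : ∀ y, HasDerivAt (fun y => f' y - δ * (κ * y)) (f'' y - δ * κ) y := fun y => by
    refine ((hf' y).sub (((hasDerivAt_id y).const_mul κ).const_mul δ)).congr_deriv ?_
    ring
  have hcont : Continuous φ := continuous_iff_continuousAt.mpr fun y => (h1 y).continuousAt
  have hev : ∀ᶠ y in cocompact ℝ, φ y ≤ φ x := by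
    filter_upwards [(tendsto_norm_cocompact_atTop (E := ℝ)).eventually_ge_atTop
      (1 + (|A| + |B|) * (2 / (δ * κ)))] with y hy
    rw [Real.norm_eq_abs] at hy
    have hK : 0 < δ * κ := mul_pos hδ hκ
    have hy1 : 1 ≤ |y| := le_trans (by simp; positivity) hy
    have hy2 : |A| + |B| ≤ δ * κ / 2 * |y| := by
      have : (|A| + |B|) * (2 / (δ * κ)) ≤ |y| := by linarith
      rw [← mul_div_assoc, div_le_iff₀ hK] at this
      linarith
    have e1 := hgrow y
    have e2 : A + B * |y| ≤ (|A| + |B|) * |y| := by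
      have := le_abs_self A
      have := le_abs_self B
      have := abs_nonneg A
      nlinarith
    have e3 : (|A| + |B|) * |y| ≤ δ * κ / 2 * |y| * |y| :=
      mul_le_mul_of_nonneg_right hy2 (abs_nonneg y)
    have e4 : |y| * |y| = y ^ 2 := by rw [abs_mul_abs_self]; ring
    have e5 : φ y = f y - δ - δ * κ / 2 * (|y| * |y|) := by rw [hφ, e4]; ring
    have e6 : 0 < φ x := hδx
    linarith
  obtain ⟨z, hz⟩ := hcont.exists_forall_ge' x hev
  have hzpos : 0 < φ z := lt_of_lt_of_le hδx (hz x)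
  have hψz := hψ z
  have hfz : 0 < f z := by
    have : φ z = f z - δ * (1 + κ / 2 * z ^ 2) := rfl
    have := mul_pos hδ hψz
    linarith
  have hd : deriv φ = fun y => f' y - δ * (κ * y) := funext fun y => (h1 y).deriv
  have hmax : IsLocalMax φ z := Eventually.of_forall hz
  have hdd : deriv (deriv φ) z = f'' z - δ * κ := by rw [hd]; exact (h2 z).deriv
  have hddpos : 0 < deriv (deriv φ) z := by
    rw [hdd]
    have e1 := hpos z hfz
    have e2 : φ z = f z - δ * (1 + κ / 2 * z ^ 2) := rfl
    have e3 : 0 ≤ κ * (δ * (κ / 2 * z ^ 2)) := by positivity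
    nlinarith
  have hmin : IsLocalMin φ z :=
    isLocalMin_of_deriv_deriv_pos hddpos hmax.deriv_eq_zero (h1 z).continuousAt
  have hconst : φ =ᶠ[𝓝 z] fun _ => φ z := by
    filter_upwards [hmin] with y hy
    exact le_antisymm (hz y) hy
  rw [hconst.deriv.deriv_eq] at hddpos
  simp at hddpos

/-- The right-hand side of the (perturbed) Painlevé III equation in logarithmic variables. -/
noncomputable def painleveRHS (α ε θ w : ℝ) : ℝ :=
  Real.exp w ^ 2 - α * Real.exp w - Real.exp θ / Real.exp w - ε * (Real.exp θ / Real.exp w) ^ 2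

lemma painleveRHS_sub_ge {α ε θ a b : ℝ} (hε : 0 ≤ ε) (hb : α ≤ Real.exp b) (hab : b ≤ a) :
    Real.exp b ^ 2 * (a - b) ≤ painleveRHS α ε θ a - painleveRHS α ε θ b := by
  have h1 : Real.exp b * (a - b) ≤ Real.exp a - Real.exp b := by
    have h := Real.add_one_le_exp (a - b)
    have e : Real.exp a = Real.exp b * Real.exp (a - b) := by rw [← Real.exp_add]; ring_nf
    rw [e]
    nlinarith [Real.exp_pos b]
  have hq := Real.exp_le_exp.mpr hab
  have h2 : Real.exp θ / Real.exp a ≤ Real.exp θ / Real.exp b := by gcongr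
  have h3 : ε * (Real.exp θ / Real.exp a) ^ 2 ≤ ε * (Real.exp θ / Real.exp b) ^ 2 := by gcongr
  have h4 : Real.exp b * (Real.exp b * (a - b))
      ≤ (Real.exp a + Real.exp b - α) * (Real.exp a - Real.exp b) :=
    mul_le_mul (by linarith) h1 (by have := Real.exp_pos b; nlinarith)
      (by have := Real.exp_pos a; linarith)
  unfold painleveRHS
  nlinarith

/-- The index-dependent scale `2n + 1 + α`. -/
noncomputable def laguerreScale (α : ℝ) (n : ℕ) : ℝ := 2 * n + 1 + α

/-- `-log` of `laguerreMean` in the logarithmic scaled variable. -/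
noncomputable def laguerreLog (α : ℝ) (n : ℕ) (θ : ℝ) : ℝ :=
  -Real.log (laguerreMean α n (Real.exp θ / laguerreScale α n))

/-- The derivative of `laguerreLog`. -/
noncomputable def laguerreLogSlope (α : ℝ) (n : ℕ) (θ : ℝ) : ℝ :=
  -(2 * laguerreLogDeriv α n (Real.exp θ / laguerreScale α n) + α
    + Real.exp θ / laguerreScale α n * laguerreMean α n (Real.exp θ / laguerreScale α n)
    - 1 / laguerreMean α n (Real.exp θ / laguerreScale α n))

section scaled

variable {α : ℝ} (hα : 0 < α) (n : ℕ)
include hα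

lemma laguerreScale_pos : 0 < laguerreScale α n := by
  unfold laguerreScale
  positivity

lemma one_le_laguerreScale : 1 ≤ laguerreScale α n := by
  unfold laguerreScale
  linarith

lemma exp_laguerreLog (θ : ℝ) :
    Real.exp (laguerreLog α n θ) = 1 / laguerreMean α n (Real.exp θ / laguerreScale α n) := by
  have := laguerreMean_pos α (div_pos (Real.exp_pos θ) (laguerreScale_pos hα n)) n
  rw [laguerreLog, Real.exp_neg, Real.exp_log this, one_div]

lemma hasDerivAt_laguerreLog (θ : ℝ) :
    HasDerivAt (laguerreLog α n) (laguerreLogSlope α n θ) θ := by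
  have ht := div_pos (Real.exp_pos θ) (laguerreScale_pos hα n)
  have hc := laguerreMean_pos α ht n
  have h1 := (Real.hasDerivAt_exp θ).div_const (laguerreScale α n)
  have h2 := (((hasDerivAt_laguerreMean α ht n).comp θ h1).log
    (by simpa using hc.ne')).neg
  refine HasDerivAt.congr_deriv h2 ?_
  rw [laguerreLogSlope, Function.comp_apply]
  generalize laguerreMean α n (Real.exp θ / laguerreScale α n) = c at *
  generalize laguerreLogDeriv α n (Real.exp θ / laguerreScale α n) = y at *
  generalize Real.exp θ / laguerreScale α n = t at *
  field_simp

lemma hasDerivAt_laguerreLogSlope (θ : ℝ) :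
    HasDerivAt (laguerreLogSlope α n)
      (painleveRHS α (1 / laguerreScale α n ^ 2) θ (laguerreLog α n θ)) θ := by
  have hN := laguerreScale_pos hα n
  have ht := div_pos (Real.exp_pos θ) hN
  have hc := laguerreMean_pos α ht n
  have h1 := (Real.hasDerivAt_exp θ).div_const (laguerreScale α n)
  have hC := (hasDerivAt_laguerreMean α ht n).comp θ h1
  have hY := (hasDerivAt_laguerreLogDeriv α ht n).comp θ h1
  refine ((((hY.const_mul 2).add_const α).add (h1.mul hC)).sub
    ((hasDerivAt_const θ (1:ℝ)).div hC hc.ne')).neg.congr_deriv ?_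
  rw [painleveRHS, exp_laguerreLog hα]
  simp only [Function.comp_apply]
  have e : Real.exp θ = laguerreScale α n * (Real.exp θ / laguerreScale α n) := by field_simp
  have eN : laguerreScale α n = 2 * n + 1 + α := rfl
  generalize laguerreMean α n (Real.exp θ / laguerreScale α n) = c at *
  generalize laguerreLogDeriv α n (Real.exp θ / laguerreScale α n) = y at *
  generalize Real.exp θ / laguerreScale α n = t at *
  rw [e]
  generalize laguerreScale α n = N at *
  have hc' := hc.ne'
  have hN' := hN.ne'
  have ht' := ht.ne'
  field_simp
  rw [eN]
  ring

lemma le_exp_laguerreLog (θ : ℝ) : α ≤ Real.exp (laguerreLog α n θ) := by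
  have ht := div_pos (Real.exp_pos θ) (laguerreScale_pos hα n)
  rw [exp_laguerreLog hα, le_div_iff₀ (laguerreMean_pos α ht n)]
  exact mul_laguerreMean_le α ht n

lemma exp_laguerreLog_le_aux (θ : ℝ) :
    Real.exp (laguerreLog α n θ) ≤ laguerreScale α n + Real.exp θ / α := by
  have hN := laguerreScale_pos hα n
  have ht := div_pos (Real.exp_pos θ) hN
  rw [exp_laguerreLog hα]
  refine (inv_laguerreMean_le α ht n).trans ?_
  have h1 : laguerreMean α n (Real.exp θ / laguerreScale α n) ≤ 1 / α := by
    rw [le_div_iff₀ hα, mul_comm]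
    exact mul_laguerreMean_le α ht n
  have h2 : Real.exp θ / laguerreScale α n ≤ Real.exp θ :=
    div_le_self (Real.exp_pos θ).le (one_le_laguerreScale hα n)
  have h3 : Real.exp θ / laguerreScale α n * laguerreMean α n (Real.exp θ / laguerreScale α n)
      ≤ Real.exp θ * (1 / α) :=
    mul_le_mul h2 h1 (laguerreMean_pos α ht n).le (Real.exp_pos θ).le
  rw [laguerreScale]
  rw [mul_one_div] at h3
  rw [laguerreScale] at h3
  linarith

end scaled

lemma le_log_add_abs_of_exp_le {w A B θ : ℝ} (hA : 0 < A) (hB : 0 ≤ B)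
    (h : Real.exp w ≤ A + B * Real.exp θ) : w ≤ Real.log (A + B) + 1 * |θ| := by
  rw [one_mul]
  have h1 : Real.exp w ≤ (A + B) * Real.exp |θ| := by
    have e1 := Real.exp_le_exp.mpr (le_abs_self θ)
    have e2 := Real.one_le_exp (abs_nonneg θ)
    nlinarith
  have hAB : 0 < A + B := by linarith
  rw [← Real.exp_log hAB, ← Real.exp_add, Real.exp_le_exp] at h1
  exact h1

/-- Globally defined solutions of the (perturbed) Painlevé III equation bounded below by `log α`
and of at most linear growth; `v'` is the derivative of `v`. -/
structure IsPainleveSol (α ε : ℝ) (v v' : ℝ → ℝ) : Prop where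
  hasDerivAt : ∀ θ, HasDerivAt v (v' θ) θ
  hasDerivAt_slope : ∀ θ, HasDerivAt v' (painleveRHS α ε θ (v θ)) θ
  le_exp : ∀ θ, α ≤ Real.exp (v θ)
  growth : ∃ A, ∀ θ, v θ ≤ A + 1 * |θ|

/-- Comparison of subsolutions and supersolutions. -/
lemma le_of_sub_super {α ε A B : ℝ} {u u' u'' w w' w'' : ℝ → ℝ} (hα : 0 < α) (hε : 0 ≤ ε)
    (hu : ∀ θ, HasDerivAt u (u' θ) θ) (hu' : ∀ θ, HasDerivAt u' (u'' θ) θ)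
    (hw : ∀ θ, HasDerivAt w (w' θ) θ) (hw' : ∀ θ, HasDerivAt w' (w'' θ) θ)
    (hle : ∀ θ, w θ < u θ → α ≤ Real.exp (w θ))
    (hsub : ∀ θ, w θ < u θ → painleveRHS α ε θ (u θ) ≤ u'' θ)
    (hsuper : ∀ θ, w θ < u θ → w'' θ ≤ painleveRHS α ε θ (w θ))
    (hgrow : ∀ θ, u θ - w θ ≤ A + B * |θ|) (θ : ℝ) : u θ ≤ w θ := by
  have h := nonpos_of_le_secondDeriv (f := fun x => u x - w x) (pow_pos hα 2)
    (fun x => (hu x).sub (hw x)) (fun x => (hu' x).sub (hw' x)) (fun x hx => ?_) hgrow θ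
  · linarith
  have hlt : w x < u x := by linarith
  have h1 := painleveRHS_sub_ge (θ := x) hε (hle x hlt) hlt.le
  have h2 : α ^ 2 ≤ Real.exp (w x) ^ 2 := by
    have := hle x hlt
    gcongr
  have h3 := mul_le_mul_of_nonneg_right h2 hx.le
  have := hsub x hlt
  have := hsuper x hlt
  linarith

namespace IsPainleveSol

variable {α ε : ℝ} {v v' : ℝ → ℝ}

lemma log_le (H : IsPainleveSol α ε v v') (hα : 0 < α) (θ : ℝ) : Real.log α ≤ v θ :=
  (Real.log_le_iff_le_exp hα).mpr (H.le_exp θ)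

lemma le_of_super (H : IsPainleveSol α ε v v') (hα : 0 < α) (hε : 0 ≤ ε) {w w' w'' : ℝ → ℝ}
    {A B : ℝ} (hw : ∀ θ, HasDerivAt w (w' θ) θ) (hw' : ∀ θ, HasDerivAt w' (w'' θ) θ)
    (hle : ∀ θ, w θ < v θ → α ≤ Real.exp (w θ))
    (hsuper : ∀ θ, w θ < v θ → w'' θ ≤ painleveRHS α ε θ (w θ))
    (hgrow : ∀ θ, A + B * |θ| ≤ w θ) (θ : ℝ) : v θ ≤ w θ := by
  obtain ⟨D, hD⟩ := H.growth
  exact le_of_sub_super hα hε H.hasDerivAt H.hasDerivAt_slope hw hw' hle (fun _ _ => le_rfl) hsuper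
    (A := D - A) (B := 1 - B) (fun x => by linarith [hD x, hgrow x]) θ

lemma ge_of_sub (H : IsPainleveSol α ε v v') (hα : 0 < α) (hε : 0 ≤ ε) {u u' u'' : ℝ → ℝ}
    {A B : ℝ} (hu : ∀ θ, HasDerivAt u (u' θ) θ) (hu' : ∀ θ, HasDerivAt u' (u'' θ) θ)
    (hsub : ∀ θ, v θ < u θ → painleveRHS α ε θ (u θ) ≤ u'' θ)
    (hgrow : ∀ θ, u θ ≤ A + B * |θ|) (θ : ℝ) : u θ ≤ v θ :=
  le_of_sub_super hα hε hu hu' H.hasDerivAt H.hasDerivAt_slope (fun x _ => H.le_exp x) hsub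
    (fun _ _ => le_rfl) (A := A - Real.log α) (B := B)
    (fun x => by linarith [H.log_le hα x, hgrow x]) θ

lemma exp_div_three_le (H : IsPainleveSol α ε v v') (hα : 0 < α) (hε : 0 ≤ ε) (θ : ℝ) :
    Real.exp (θ / 3) ≤ Real.exp (v θ) := by
  rw [Real.exp_le_exp]
  refine H.ge_of_sub hα hε (A := 0) (B := 1 / 3) (u := fun x => x / 3) (u' := fun _ => 1 / 3)
    (u'' := fun _ => 0) (fun x => (hasDerivAt_id x).div_const 3) (fun x => hasDerivAt_const x _)
    (fun x _ => ?_) (fun x => ?_) θ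
  · have e : Real.exp x = Real.exp (x / 3) ^ 3 := by rw [← Real.exp_nat_mul]; push_cast; ring_nf
    have hp := Real.exp_pos (x / 3)
    rw [painleveRHS, e]
    generalize Real.exp (x / 3) = q at *
    have e2 : q ^ 3 / q = q ^ 2 := by field_simp
    rw [e2]
    have : 0 ≤ ε * (q ^ 2) ^ 2 := by positivity
    nlinarith
  · have := le_abs_self x
    linarith

lemma exp_le (H : IsPainleveSol α ε v v') (hα : 0 < α) (hε : 0 ≤ ε) (hε1 : ε ≤ 1) (θ : ℝ) :
    Real.exp (v θ) ≤ (α + 2) * (1 + Real.exp θ) := by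
  have hpos : ∀ x, 0 < 1 + Real.exp x := fun x => by positivity
  have hexp : ∀ x, Real.exp (Real.log (α + 2) + Real.log (1 + Real.exp x))
      = (α + 2) * (1 + Real.exp x) := fun x => by
    rw [Real.exp_add, Real.exp_log (hpos x), Real.exp_log (by linarith)]
  rw [← hexp, Real.exp_le_exp]
  refine H.le_of_super hα hε (A := 0) (B := 0)
    (w := fun x => Real.log (α + 2) + Real.log (1 + Real.exp x))
    (w' := fun x => Real.exp x / (1 + Real.exp x))
    (w'' := fun x => Real.exp x / (1 + Real.exp x) ^ 2) (fun x => ?_) (fun x => ?_) (fun x _ => ?_)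
    (fun x _ => ?_) (fun x => ?_) θ
  · exact (((Real.hasDerivAt_exp x).const_add 1).log (hpos x).ne').const_add _
  · refine ((Real.hasDerivAt_exp x).div ((Real.hasDerivAt_exp x).const_add 1)
      (hpos x).ne').congr_deriv ?_
    ring
  · rw [hexp]
    have := Real.exp_pos x
    nlinarith
  · rw [painleveRHS, hexp]
    have hs := Real.exp_pos x
    generalize Real.exp x = s at *
    have h1 : s / (1 + s) ^ 2 ≤ 1 := by
      rw [div_le_one (by positivity)]
      nlinarith
    have h2 : s / ((α + 2) * (1 + s)) ≤ 1 := by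
      rw [div_le_one (by positivity)]
      nlinarith
    have h3 : 0 ≤ s / ((α + 2) * (1 + s)) := by positivity
    generalize s / ((α + 2) * (1 + s)) = y at *
    have h4 : ε * y ^ 2 ≤ 1 := by nlinarith
    have h6 : 2 ≤ (α + 2) * (1 + s) - α := by nlinarith
    nlinarith
  · have := Real.log_nonneg (show (1:ℝ) ≤ α + 2 by linarith)
    have := Real.log_nonneg (show 1 ≤ 1 + Real.exp x by linarith [Real.exp_pos x])
    linarith

/-- Solutions decrease as the perturbation parameter decreases. -/
lemma le_of_le {δ : ℝ} {u u' : ℝ → ℝ} (H : IsPainleveSol α ε v v') (K : IsPainleveSol α δ u u')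
    (hα : 0 < α) (hδ : 0 ≤ δ) (hδε : δ ≤ ε) (θ : ℝ) : u θ ≤ v θ := by
  obtain ⟨D, hD⟩ := K.growth
  refine H.ge_of_sub hα (hδ.trans hδε) K.hasDerivAt K.hasDerivAt_slope (fun x _ => ?_) hD θ
  unfold painleveRHS
  gcongr

/-- Solutions depend on the perturbation parameter in a Lipschitz way. -/
lemma le_add {δ : ℝ} {u u' : ℝ → ℝ} (H : IsPainleveSol α ε v v') (K : IsPainleveSol α δ u u')
    (hα : 0 < α) (hδ : 0 ≤ δ) (hδε : δ ≤ ε) (θ : ℝ) :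
    v θ ≤ u θ + ε * (1 + Real.exp (2 / 3 * θ)) := by
  obtain ⟨D, hD⟩ := H.growth
  have hε := hδ.trans hδε
  have hη : ∀ x, HasDerivAt (fun x => ε * (1 + Real.exp (2 / 3 * x)))
      (ε * (2 / 3 * Real.exp (2 / 3 * x))) x := fun x => by
    refine ((((hasDerivAt_id x).const_mul (2 / 3)).exp.const_add 1).const_mul ε).congr_deriv ?_
    simp only [id]
    ring
  have hη' : ∀ x, HasDerivAt (fun x => ε * (2 / 3 * Real.exp (2 / 3 * x)))
      (ε * (4 / 9 * Real.exp (2 / 3 * x))) x := fun x => by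
    refine ((((hasDerivAt_id x).const_mul (2 / 3)).exp.const_mul (2 / 3)).const_mul
      ε).congr_deriv ?_
    simp only [id]
    ring
  have h := nonpos_of_le_secondDeriv (A := D - Real.log α) (B := 1)
    (f := fun x => v x - u x - ε * (1 + Real.exp (2 / 3 * x))) (pow_pos hα 2)
    (fun x => ((H.hasDerivAt x).sub (K.hasDerivAt x)).sub (hη x))
    (fun x => ((H.hasDerivAt_slope x).sub (K.hasDerivAt_slope x)).sub (hη' x)) ?_ ?_ θ
  · linarith
  · intro x hx
    have hη0 : 0 ≤ ε * (1 + Real.exp (2 / 3 * x)) := by positivity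
    have huv : u x ≤ v x := by linarith
    have h1 := painleveRHS_sub_ge (θ := x) hδ (K.le_exp x) huv
    have h2 : painleveRHS α ε x (v x)
        = painleveRHS α δ x (v x) - (ε - δ) * (Real.exp x / Real.exp (v x)) ^ 2 := by
      unfold painleveRHS
      ring
    set y := Real.exp (x / 3) with hy
    have hy0 : 0 < y := Real.exp_pos _
    have e1 : Real.exp x = y ^ 3 := by rw [hy, ← Real.exp_nat_mul]; push_cast; ring_nf
    have e2 : Real.exp (2 / 3 * x) = y ^ 2 := by rw [hy, ← Real.exp_nat_mul]; push_cast; ring_nf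
    have h3 : Real.exp x / Real.exp (v x) ≤ y ^ 2 := by
      rw [div_le_iff₀ (Real.exp_pos _), e1]
      have := mul_le_mul_of_nonneg_left (H.exp_div_three_le hα hε x) (pow_pos hy0 2).le
      rw [← hy] at this
      linarith
    have h4 : (Real.exp x / Real.exp (v x)) ^ 2 ≤ (y ^ 2) ^ 2 := by gcongr
    have h5 : (ε - δ) * (Real.exp x / Real.exp (v x)) ^ 2 ≤ ε * (y ^ 2) ^ 2 :=
      mul_le_mul (by linarith) h4 (by positivity) hε
    have h6 : α ^ 2 ≤ Real.exp (u x) ^ 2 := by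
      have := K.le_exp x
      gcongr
    have h7 : y ^ 2 ≤ Real.exp (u x) ^ 2 := by
      have := K.exp_div_three_le hα hδ x
      gcongr
    rw [e2] at hx hη0 ⊢
    have h8 := mul_le_mul_of_nonneg_right h6 hx.le
    have h9 := mul_le_mul_of_nonneg_right h7 hη0
    have h10 : 0 ≤ ε * y ^ 2 := by positivity
    nlinarith
  · intro x
    have hη0 : 0 ≤ ε * (1 + Real.exp (2 / 3 * x)) := by positivity
    linarith [hD x, K.log_le hα x]

section unperturbed

variable (H : IsPainleveSol α 0 v v') (hα : 0 < α)
include H hα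

lemma exp_le_add (θ : ℝ) : Real.exp (v θ) ≤ α + 1 + Real.exp (θ / 3) := by
  have hpos : ∀ x, 0 < α + 1 + Real.exp (x / 3) := fun x => by positivity
  rw [← Real.exp_log (hpos θ), Real.exp_le_exp]
  have hd : ∀ x, HasDerivAt (fun x => Real.exp (x / 3)) (Real.exp (x / 3) / 3) x := fun x => by
    refine (((hasDerivAt_id x).div_const 3).exp).congr_deriv ?_
    simp
    ring
  refine H.le_of_super hα le_rfl (A := 0) (B := 0)
    (w := fun x => Real.log (α + 1 + Real.exp (x / 3)))
    (w' := fun x => Real.exp (x / 3) / 3 / (α + 1 + Real.exp (x / 3)))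
    (w'' := fun x => (α + 1) * Real.exp (x / 3) / 9 / (α + 1 + Real.exp (x / 3)) ^ 2)
    (fun x => ?_) (fun x => ?_) (fun x _ => ?_) (fun x _ => ?_) (fun x => ?_) θ
  · exact ((hd x).const_add (α + 1)).log (hpos x).ne'
  · refine (((hd x).div_const 3).div ((hd x).const_add (α + 1)) (hpos x).ne').congr_deriv ?_
    ring
  · rw [Real.exp_log (hpos x)]
    linarith [Real.exp_pos (x / 3)]
  · have e : Real.exp x = Real.exp (x / 3) ^ 3 := by rw [← Real.exp_nat_mul]; push_cast; ring_nf
    have hy := Real.exp_pos (x / 3)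
    rw [painleveRHS, Real.exp_log (hpos x), e]
    generalize Real.exp (x / 3) = y at *
    have h0 : 0 < α + 1 + y := by linarith
    have h1 : (α + 1) * y / 9 / (α + 1 + y) ^ 2 ≤ 1 := by
      rw [div_le_one (by positivity)]
      nlinarith [sq_nonneg (α + 1), sq_nonneg y, mul_pos hα hy]
    have h2 : y ^ 3 / (α + 1 + y) ≤ y ^ 2 := by
      rw [div_le_iff₀ h0]
      nlinarith [sq_nonneg y, mul_pos hα hy]
    have h3 : y ^ 3 / (α + 1 + y) ≤ (α + 1 + y) ^ 2 - α * (α + 1 + y) - 1 := by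
      nlinarith [mul_pos hα hy]
    linarith
  · have := Real.log_nonneg (show 1 ≤ α + 1 + Real.exp (x / 3) by linarith [Real.exp_pos (x / 3)])
    linarith

lemma monotone : Monotone v := by
  intro a b hab
  have h := H.le_of_super hα le_rfl (A := Real.log α) (B := 0)
    (w := fun x => v (x + (b - a))) (w' := fun x => v' (x + (b - a)))
    (w'' := fun x => painleveRHS α 0 (x + (b - a)) (v (x + (b - a))))
    (fun x => (H.hasDerivAt _).comp_add_const x _)
    (fun x => (H.hasDerivAt_slope _).comp_add_const x _)
    (fun x _ => H.le_exp _) (fun x _ => ?_) (fun x => by linarith [H.log_le hα (x + (b - a))]) a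
  · simpa using h
  · unfold painleveRHS
    have : Real.exp x ≤ Real.exp (x + (b - a)) := Real.exp_le_exp.mpr (by linarith)
    simp only [zero_mul]
    gcongr

lemma monotone_sub : Monotone fun θ => θ - v θ := by
  intro a b hab
  obtain ⟨D, hD⟩ := H.growth
  have hk : 0 ≤ b - a := by linarith
  have h := H.ge_of_sub hα le_rfl (A := D) (B := 1)
    (u := fun x => v (x + (b - a)) - (b - a)) (u' := fun x => v' (x + (b - a)))
    (u'' := fun x => painleveRHS α 0 (x + (b - a)) (v (x + (b - a))))
    (fun x => ((H.hasDerivAt _).comp_add_const x _).sub_const (b - a))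
    (fun x => (H.hasDerivAt_slope _).comp_add_const x _)
    (fun x hx => ?_) (fun x => ?_) a
  · simp only [add_sub_cancel] at h
    change a - v a ≤ b - v b
    linarith
  · have e1 : Real.exp (v (x + (b - a)))
        = Real.exp (v (x + (b - a)) - (b - a)) * Real.exp (b - a) := by
      rw [← Real.exp_add, sub_add_cancel]
    have e2 : Real.exp (x + (b - a)) / Real.exp (v (x + (b - a)))
        = Real.exp x / Real.exp (v (x + (b - a)) - (b - a)) := by
      rw [e1, Real.exp_add, mul_div_mul_right _ _ (Real.exp_pos _).ne']
    have h1 := Real.one_le_exp hk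
    have h2 := (H.le_exp x).trans (Real.exp_le_exp.mpr hx.le)
    rw [painleveRHS, painleveRHS, e2, e1]
    generalize Real.exp (v (x + (b - a)) - (b - a)) = q at *
    generalize Real.exp (b - a) = k at *
    have h3 : 0 ≤ (k - 1) * q * ((k + 1) * q - α) := by
      refine mul_nonneg (mul_nonneg (by linarith) (by linarith)) (by nlinarith)
    linarith
  · have h1 := hD (x + (b - a))
    have h2 := abs_add_le x (b - a)
    rw [abs_of_nonneg hk] at h2
    linarith

lemma slope_nonneg (θ : ℝ) : 0 ≤ v' θ := by
  exact (H.hasDerivAt θ).nonneg_of_monotone (H.monotone hα)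

lemma slope_le_one (θ : ℝ) : v' θ ≤ 1 := by
  have h := ((hasDerivAt_id θ).sub (H.hasDerivAt θ)).nonneg_of_monotone (H.monotone_sub hα)
  linarith

end unperturbed

end IsPainleveSol

lemma isPainleveSol_laguerreLog {α : ℝ} (hα : 0 < α) (n : ℕ) :
    IsPainleveSol α (1 / laguerreScale α n ^ 2) (laguerreLog α n) (laguerreLogSlope α n) where
  hasDerivAt := hasDerivAt_laguerreLog hα n
  hasDerivAt_slope := hasDerivAt_laguerreLogSlope hα n
  le_exp := le_exp_laguerreLog hα n
  growth := ⟨_, fun θ => le_log_add_abs_of_exp_le (laguerreScale_pos hα n)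
    (inv_nonneg.mpr hα.le) ((exp_laguerreLog_le_aux hα n θ).trans_eq (by ring))⟩

lemma exists_limit_of_abs_sub_le {f : ℕ → ℝ → ℝ} {E : ℝ → ℝ} {ε : ℕ → ℝ}
    (hε : Tendsto ε atTop (𝓝 0)) (h : ∀ j k x, j ≤ k → |f j x - f k x| ≤ ε j * E x) :
    ∃ g : ℝ → ℝ, (∀ x, Tendsto (fun j => f j x) atTop (𝓝 (g x))) ∧
      ∀ j x, |f j x - g x| ≤ ε j * E x := by
  have hc : ∀ x, CauchySeq fun j => f j x := fun x => by
    refine cauchySeq_of_le_tendsto_0 (fun N => ε N * E x + ε N * E x) (fun n m N hn hm => ?_) ?_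
    · refine (dist_triangle_left _ _ (f N x)).trans (add_le_add ?_ ?_)
      · exact h N n x hn
      · exact h N m x hm
    · simpa using (hε.mul_const (E x)).add (hε.mul_const (E x))
  choose g hg using fun x => cauchySeq_tendsto_of_complete (hc x)
  refine ⟨g, hg, fun j x => ?_⟩
  exact le_of_tendsto ((hg x).const_sub (f j x)).abs
    ((eventually_ge_atTop j).mono fun k hk => h j k x hk)

lemma hasDerivAt_of_abs_sub_le {f f' : ℕ → ℝ → ℝ} {g g' E : ℝ → ℝ} {ε : ℕ → ℝ}
    (hε : Tendsto ε atTop (𝓝 0)) (hE : Monotone E) (hf : ∀ j x, HasDerivAt (f j) (f' j x) x)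
    (hg : ∀ x, Tendsto (fun j => f j x) atTop (𝓝 (g x)))
    (h : ∀ j x, |f' j x - g' x| ≤ ε j * E x) (hε0 : ∀ j, 0 ≤ ε j) (x : ℝ) :
    HasDerivAt g (g' x) x := by
  refine hasDerivAt_of_tendstoUniformlyOn (s := Iio (x + 1)) (l := atTop) (f := f) (f' := f')
    isOpen_Iio (Metric.tendstoUniformlyOn_iff.mpr fun δ hδ => ?_)
    (Eventually.of_forall fun j y _ => hf j y) (fun y _ => hg y) (by simp)
  have hl : Tendsto (fun j => ε j * E (x + 1)) atTop (𝓝 0) := by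
    simpa using hε.mul_const (E (x + 1))
  filter_upwards [hl.eventually_lt_const hδ] with j hj y hy
  rw [dist_comm, Real.dist_eq]
  exact ((h j y).trans (mul_le_mul_of_nonneg_left (hE (le_of_lt hy)) (hε0 j))).trans_lt hj

/-- A first-derivative bound from bounds on the function and its second derivative. -/
lemma abs_deriv_le {f f' f'' : ℝ → ℝ} {a b x : ℝ} (hf : ∀ y, HasDerivAt f (f' y) y)
    (hf' : ∀ y, HasDerivAt f' (f'' y) y) (ha : |f (x + 1) - f x| ≤ a)
    (hb : ∀ y ∈ Ioo x (x + 1), |f'' y| ≤ b) : |f' x| ≤ a + b := by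
  obtain ⟨c, hc, hce⟩ := exists_hasDerivAt_eq_slope f f' (show x < x + 1 by linarith)
    (fun y _ => (hf y).continuousAt.continuousWithinAt) fun y _ => hf y
  obtain ⟨e, he, hee⟩ := exists_hasDerivAt_eq_slope f' f'' hc.1
    (fun y _ => (hf' y).continuousAt.continuousWithinAt) fun y _ => hf' y
  have h1 := hb e ⟨he.1, he.2.trans hc.2⟩
  have hcx : 0 < c - x := by linarith [hc.1]
  rw [eq_div_iff hcx.ne'] at hee
  have h2 : f' x = (f (x + 1) - f x) - f'' e * (c - x) := by
    rw [hee, hce]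
    ring
  rw [h2]
  refine (abs_sub _ _).trans (add_le_add ha ?_)
  rw [abs_mul, abs_of_pos hcx]
  have := abs_nonneg (f'' e)
  nlinarith [hc.2]

lemma abs_painleveRHS_sub_le {α ε δ θ a b Q : ℝ} (hα : 0 < α) (hδ : 0 ≤ δ) (hδε : δ ≤ ε)
    (hb : α ≤ Real.exp b) (hab : b ≤ a) (hQ : Real.exp a ≤ Q) :
    |painleveRHS α ε θ a - painleveRHS α δ θ b|
      ≤ (2 * Q + α + Real.exp θ / α ^ 2) * (Q * (a - b)) + ε * (Real.exp θ / α) ^ 2 := by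
  have hs := Real.exp_pos θ
  have hpq := Real.exp_le_exp.mpr hab
  have hp0 := Real.exp_pos b
  have hlip : Real.exp a - Real.exp b ≤ Q * (a - b) := by
    have h := Real.add_one_le_exp (b - a)
    have e : Real.exp b = Real.exp a * Real.exp (b - a) := by rw [← Real.exp_add]; ring_nf
    have h1 : Real.exp a - Real.exp b ≤ Real.exp a * (a - b) := by
      rw [e]
      nlinarith [Real.exp_pos a]
    have h2 := mul_le_mul_of_nonneg_right hQ (sub_nonneg.mpr hab)
    linarith
  unfold painleveRHS at *
  generalize Real.exp a = q at *
  generalize Real.exp b = p at *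
  generalize Real.exp θ = s at *
  generalize hd : Q * (a - b) = d at *
  have hq0 : 0 < q := by linarith
  have hd0 : 0 ≤ d := by linarith
  have h1 : s / p - s / q ≤ s / α ^ 2 * d := by
    have e : s / p - s / q = s / (p * q) * (q - p) := by field_simp
    rw [e]
    have h2 : α ^ 2 ≤ p * q := by nlinarith
    have h3 : s / (p * q) ≤ s / α ^ 2 := by gcongr
    exact mul_le_mul h3 hlip (by linarith) (by positivity)
  have h1' : 0 ≤ s / p - s / q := sub_nonneg.mpr (by gcongr)
  have h4 : (s / q) ^ 2 ≤ (s / α) ^ 2 := by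
    gcongr
    linarith
  have h5 : (s / p) ^ 2 ≤ (s / α) ^ 2 := by gcongr
  have hε := hδ.trans hδε
  have h6 : ε * (s / q) ^ 2 ≤ ε * (s / α) ^ 2 := by gcongr
  have h7 : δ * (s / p) ^ 2 ≤ ε * (s / α) ^ 2 := by gcongr
  have h6' : 0 ≤ ε * (s / q) ^ 2 := by positivity
  have h7' : 0 ≤ δ * (s / p) ^ 2 := by positivity
  have h8 : 0 ≤ (q - p) * (q + p) := mul_nonneg (by linarith) (by linarith)
  have h9 : (q - p) * (q + p) ≤ d * (2 * Q) :=
    mul_le_mul hlip (by linarith) (by linarith) hd0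
  have h10 : α * (q - p) ≤ α * d := by gcongr
  have h11 : 0 ≤ α * (q - p) := mul_nonneg hα.le (by linarith)
  rw [abs_le]
  constructor <;> nlinarith

/-- Solutions of the perturbed equations converge to a solution of the unperturbed one. -/
lemma exists_limit_solution {α : ℝ} (hα : 0 < α) {ε : ℕ → ℝ} {u u' : ℕ → ℝ → ℝ}
    (hε : Tendsto ε atTop (𝓝 0)) (hanti : Antitone ε) (hε0 : ∀ j, 0 ≤ ε j) (hε1 : ∀ j, ε j ≤ 1)
    (H : ∀ j, IsPainleveSol α (ε j) (u j) (u' j)) :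
    ∃ v v' : ℝ → ℝ, IsPainleveSol α 0 v v' ∧
      ∀ j x, |u j x - v x| ≤ ε j * (1 + Real.exp (2 / 3 * x)) := by
  set η : ℝ → ℝ := fun x => 1 + Real.exp (2 / 3 * x) with hη
  set Q : ℝ → ℝ := fun x => (α + 2) * (1 + Real.exp x) with hQ
  set E : ℝ → ℝ := fun x => (2 * Q x + α + Real.exp x / α ^ 2) * (Q x * η x)
    + (Real.exp x / α) ^ 2 with hE
  have hQ0 : ∀ x, 0 ≤ Q x := fun x => by positivity
  have hηm : Monotone η := fun x y hxy => by simp only [hη]; gcongr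
  have hQm : Monotone Q := fun x y hxy => by simp only [hQ]; gcongr
  have hEm : Monotone E := fun x y hxy => by
    have h1 := hηm hxy
    have h2 := hQm hxy
    simp only [hE]
    gcongr
  have hle : ∀ j k x, j ≤ k → u k x ≤ u j x := fun j k x hjk =>
    (H j).le_of_le (H k) hα (hε0 k) (hanti hjk) x
  have hadd : ∀ j k x, j ≤ k → u j x - u k x ≤ ε j * η x := fun j k x hjk => by
    have := (H j).le_add (H k) hα (hε0 k) (hanti hjk) x
    simp only [hη]
    linarith
  have hcl : ∀ j k x, j ≤ k → |u j x - u k x| ≤ ε j * η x := fun j k x hjk => by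
    rw [abs_of_nonneg (sub_nonneg.mpr (hle j k x hjk))]
    exact hadd j k x hjk
  have hrhs : ∀ j δ w x, 0 ≤ δ → δ ≤ ε j → α ≤ Real.exp w → w ≤ u j x → u j x - w ≤ ε j * η x →
      |painleveRHS α (ε j) x (u j x) - painleveRHS α δ x w| ≤ ε j * E x := by
    intro j δ w x hδ hδε hw hwu hd
    refine (abs_painleveRHS_sub_le hα hδ hδε hw hwu ((H j).exp_le hα (hε0 j) (hε1 j) x)).trans ?_
    have h1 : 0 ≤ 2 * Q x + α + Real.exp x / α ^ 2 := by
      positivity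
    have h2 := mul_le_mul_of_nonneg_left (mul_le_mul_of_nonneg_left hd (hQ0 x)) h1
    simp only [hE]
    simp only [hQ] at h2 ⊢
    linarith
  have hslope : ∀ j k x, j ≤ k → |u' j x - u' k x| ≤ ε j * (η (x + 1) + E (x + 1)) := by
    intro j k x hjk
    rw [mul_add]
    refine abs_deriv_le (f' := fun y => u' j y - u' k y)
      (fun y => ((H j).hasDerivAt y).sub ((H k).hasDerivAt y))
      (fun y => ((H j).hasDerivAt_slope y).sub ((H k).hasDerivAt_slope y)) ?_ fun y hy => ?_
    · have h1 := hle j k (x + 1) hjk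
      have h2 := hadd j k (x + 1) hjk
      have h3 := hle j k x hjk
      have h4 := hadd j k x hjk
      have h5 := mul_le_mul_of_nonneg_left (hηm (show x ≤ x + 1 by linarith)) (hε0 j)
      simp only [Pi.sub_apply]
      rw [abs_le]
      constructor <;> linarith
    · exact (hrhs j (ε k) (u k y) y (hε0 k) (hanti hjk) ((H k).le_exp y) (hle j k y hjk)
        (hadd j k y hjk)).trans (mul_le_mul_of_nonneg_left (hEm hy.2.le) (hε0 j))
  obtain ⟨v, hv, hvb⟩ := exists_limit_of_abs_sub_le hε hcl
  obtain ⟨v', hv', hvb'⟩ := exists_limit_of_abs_sub_le hε hslope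
  have hvu : ∀ j x, v x ≤ u j x := fun j x =>
    le_of_tendsto (hv x) ((eventually_ge_atTop j).mono fun k hk => hle j k x hk)
  have hαv : ∀ x, α ≤ Real.exp (v x) := fun x =>
    ge_of_tendsto' ((Real.continuous_exp.tendsto _).comp (hv x)) fun j => (H j).le_exp x
  refine ⟨v, v', ⟨fun x => ?_, fun x => ?_, hαv, ?_⟩, hvb⟩
  · exact hasDerivAt_of_abs_sub_le hε (E := fun x => η (x + 1) + E (x + 1))
      (fun x y hxy => add_le_add (hηm (by linarith)) (hEm (by linarith)))
      (fun j y => (H j).hasDerivAt y) hv hvb' hε0 x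
  · exact hasDerivAt_of_abs_sub_le hε (g' := fun x => painleveRHS α 0 x (v x)) hEm
      (fun j y => (H j).hasDerivAt_slope y) hv'
      (fun j y => hrhs j 0 (v y) y le_rfl (hε0 j) (hαv y) (hvu j y)
        ((le_abs_self _).trans (hvb j y))) hε0 x
  · obtain ⟨A, hA⟩ := (H 0).growth
    exact ⟨A, fun x => (hvu 0 x).trans (hA x)⟩

/-- The limiting solution of the Painlevé III equation and its distance to `laguerreLog`. -/
lemma exists_laguerreLog_limit {α : ℝ} (hα : 0 < α) :
    ∃ v v' : ℝ → ℝ, IsPainleveSol α 0 v v' ∧ ∀ j x,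
      |laguerreLog α j x - v x| ≤ 1 / laguerreScale α j ^ 2 * (1 + Real.exp (2 / 3 * x)) := by
  refine exists_limit_solution hα ?_ (fun j k hjk => ?_) (fun j => by positivity) (fun j => ?_)
    (isPainleveSol_laguerreLog hα)
  · have h1 : Tendsto (laguerreScale α) atTop atTop :=
      tendsto_atTop_mono (fun n => by
        unfold laguerreScale
        linarith) tendsto_natCast_atTop_atTop
    simpa [one_div] using (h1.comp tendsto_id |>.atTop_mul_atTop₀ h1).inv_tendsto_atTop.congr
      fun n => by simp [sq]
  · have h1 := laguerreScale_pos hα j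
    have h2 : laguerreScale α j ≤ laguerreScale α k := by
      unfold laguerreScale
      gcongr
    exact one_div_le_one_div_of_le (by positivity) (by gcongr)
  · rw [div_le_one (pow_pos (laguerreScale_pos hα j) 2)]
    exact one_le_pow₀ (one_le_laguerreScale hα j)

namespace IsPainleveSol

variable {α : ℝ} {v v' : ℝ → ℝ} (H : IsPainleveSol α 0 v v')
include H

omit H in
lemma painleveRHS_eq (θ : ℝ) : painleveRHS α 0 θ (v θ)
    = Real.exp (v θ) * (Real.exp (v θ) - α) - Real.exp θ / Real.exp (v θ) := by
  unfold painleveRHS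
  ring

lemma contDiff (n : ℕ) : ContDiff ℝ n v ∧ ContDiff ℝ n v' := by
  induction n with
  | zero =>
    simp only [Nat.cast_zero, contDiff_zero]
    exact ⟨continuous_iff_continuousAt.mpr fun θ => (H.hasDerivAt θ).continuousAt,
      continuous_iff_continuousAt.mpr fun θ => (H.hasDerivAt_slope θ).continuousAt⟩
  | succ n ih =>
    have e : ((n + 1 : ℕ) : WithTop ℕ∞) = (n : WithTop ℕ∞) + 1 := by push_cast; rfl
    have hd : deriv v = v' := funext fun θ => (H.hasDerivAt θ).deriv
    have hd' : deriv v' = fun θ => painleveRHS α 0 θ (v θ) :=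
      funext fun θ => (H.hasDerivAt_slope θ).deriv
    rw [e, contDiff_succ_iff_deriv, contDiff_succ_iff_deriv, hd, hd']
    refine ⟨⟨fun θ => (H.hasDerivAt θ).differentiableAt, by simp, ih.2⟩,
      fun θ => (H.hasDerivAt_slope θ).differentiableAt, by simp, ?_⟩
    have h1 := ih.1.exp
    have h2 := (Real.contDiff_exp (n := n)).div h1 fun θ => (Real.exp_pos _).ne'
    exact (((h1.pow 2).sub (contDiff_const.mul h1)).sub h2).sub (contDiff_const.mul (h2.pow 2))

lemma contDiff_infty : ContDiff ℝ (⊤ : ℕ∞) v ∧ ContDiff ℝ (⊤ : ℕ∞) v' :=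
  ⟨_root_.contDiff_infty.mpr fun n => (H.contDiff n).1,
    _root_.contDiff_infty.mpr fun n => (H.contDiff n).2⟩

variable (hα : 0 < α)
include hα

lemma tendsto_atBot : Tendsto (fun θ => Real.exp (v θ)) atBot (𝓝 α) := by
  refine Metric.tendsto_nhds.mpr fun δ hδ => ?_
  suffices h : ∃ θ, Real.exp (v θ) < α + δ by
    obtain ⟨θ, hθ⟩ := h
    filter_upwards [Iic_mem_atBot θ] with x hx
    have h1 := Real.exp_le_exp.mpr (H.monotone hα hx)
    have h2 := H.le_exp x
    rw [Real.dist_eq, abs_of_nonneg (by linarith)]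
    linarith
  by_contra! hcon
  have hκ : 0 < α * δ / 2 := by positivity
  obtain ⟨θ, hθ⟩ : ∃ θ, ∀ x ≤ θ, Real.exp x ≤ α * (α * δ / 2) := by
    have := Real.tendsto_exp_atBot.eventually_le_const (show 0 < α * (α * δ / 2) by positivity)
    exact eventually_atBot.mp this
  have hge : ∀ x ≤ θ, α * δ / 2 ≤ painleveRHS α 0 x (v x) := fun x hx => by
    rw [painleveRHS_eq]
    have h1 := hcon x
    have h3 : Real.exp x / Real.exp (v x) ≤ α * δ / 2 := by
      rw [div_le_iff₀ (Real.exp_pos _)]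
      have := hθ x hx
      nlinarith
    nlinarith
  have hlt : θ - 2 / (α * δ / 2) < θ := by
    have : 0 < 2 / (α * δ / 2) := by positivity
    linarith
  obtain ⟨c, hc, hce⟩ := exists_hasDerivAt_eq_slope v' (fun x => painleveRHS α 0 x (v x)) hlt
    (fun y _ => (H.hasDerivAt_slope y).continuousAt.continuousWithinAt)
    fun y _ => H.hasDerivAt_slope y
  have h1 := hge c hc.2.le
  rw [hce, le_div_iff₀ (by linarith)] at h1
  have h2 := H.slope_le_one hα θ
  have h3 := H.slope_nonneg hα (θ - 2 / (α * δ / 2))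
  have e : α * δ / 2 * (θ - (θ - 2 / (α * δ / 2))) = 2 := by
    field_simp
    ring
  linarith

lemma slope_tendsto_atBot : Tendsto v' atBot (𝓝 0) := by
  have hq := H.tendsto_atBot hα
  have hsh : Tendsto (fun θ : ℝ => θ + 1) atBot atBot :=
    tendsto_atBot_add_const_right _ _ tendsto_id
  have hq1 := hq.comp hsh
  have hv : Tendsto v atBot (𝓝 (Real.log α)) := by
    simpa [Function.comp_def] using ((Real.continuousAt_log hα.ne').tendsto.comp hq)
  have hb : Tendsto (fun θ => v (θ + 1) - v θ + (Real.exp (v (θ + 1)) * (Real.exp (v (θ + 1)) - α)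
      + Real.exp (θ + 1) / α)) atBot (𝓝 0) := by
    have h1 := ((hv.comp hsh).sub hv).add ((hq1.mul (hq1.sub_const α)).add
      ((Real.tendsto_exp_atBot.comp hsh).div_const α))
    simpa using h1
  refine squeeze_zero (H.slope_nonneg hα) (fun x => ?_) hb
  have hm := H.monotone hα
  refine (le_abs_self _).trans (abs_deriv_le H.hasDerivAt H.hasDerivAt_slope
    (abs_of_nonneg (sub_nonneg.mpr (hm (by linarith)))).le fun y hy => ?_)
  rw [painleveRHS_eq]
  have h1 := H.le_exp y
  have h2 := Real.exp_le_exp.mpr (hm hy.2.le)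
  have h3 : Real.exp y / Real.exp (v y) ≤ Real.exp (x + 1) / α := by
    have := hy.2
    gcongr
  have h4 : 0 ≤ Real.exp y / Real.exp (v y) := by positivity
  have h5 : 0 ≤ Real.exp (v y) * (Real.exp (v y) - α) :=
    mul_nonneg (Real.exp_pos _).le (by linarith)
  have h6 : Real.exp (v y) * (Real.exp (v y) - α)
      ≤ Real.exp (v (x + 1)) * (Real.exp (v (x + 1)) - α) :=
    mul_le_mul h2 (by linarith) (by linarith) (Real.exp_pos _).le
  rw [abs_le]
  constructor <;> linarith

end IsPainleveSol

/-- The Hamiltonian-type function whose derivative is `e^{-v(log s)}`, extended by its limit at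
`0`. -/
noncomputable def painlevePrimitive (α : ℝ) (v v' : ℝ → ℝ) (s : ℝ) : ℝ :=
  if 0 < s then (1 / 4 + 2 * (s / Real.exp (v (Real.log s))) - 2 * α * Real.exp (v (Real.log s))
    + Real.exp (v (Real.log s)) ^ 2 - v' (Real.log s) ^ 2) / 2 else (1 - 4 * α ^ 2) / 8

namespace IsPainleveSol

variable {α : ℝ} {v v' : ℝ → ℝ} (H : IsPainleveSol α 0 v v')

omit H in
lemma painlevePrimitive_eq {s : ℝ} (hs : 0 < s) : painlevePrimitive α v v' s
    = (1 / 4 + 2 * (s / Real.exp (v (Real.log s))) - 2 * α * Real.exp (v (Real.log s))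
      + Real.exp (v (Real.log s)) ^ 2 - v' (Real.log s) ^ 2) / 2 := if_pos hs

omit H in
lemma painlevePrimitive_eventuallyEq {s : ℝ} (hs : 0 < s) : painlevePrimitive α v v' =ᶠ[𝓝 s]
    fun s => (1 / 4 + 2 * (s / Real.exp (v (Real.log s))) - 2 * α * Real.exp (v (Real.log s))
      + Real.exp (v (Real.log s)) ^ 2 - v' (Real.log s) ^ 2) / 2 :=
  (lt_mem_nhds hs).mono fun _ h => painlevePrimitive_eq h

include H

lemma contDiffAt_painlevePrimitive {s : ℝ} (hs : 0 < s) :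
    ContDiffAt ℝ (⊤ : ℕ∞) (painlevePrimitive α v v') s := by
  refine ContDiffAt.congr_of_eventuallyEq ?_ (painlevePrimitive_eventuallyEq hs)
  have hlog : ContDiffAt ℝ (⊤ : ℕ∞) Real.log s := Real.contDiffAt_log.mpr hs.ne'
  have hv := (H.contDiff_infty.1.contDiffAt.comp s hlog).exp
  have hv' := H.contDiff_infty.2.contDiffAt.comp s hlog
  exact (((((contDiffAt_const.add (contDiffAt_const.mul (contDiffAt_id.div hv
    (Real.exp_pos _).ne'))).sub (contDiffAt_const.mul hv)).add (hv.pow 2)).sub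
    (hv'.pow 2))).div_const 2

lemma hasDerivAt_exp_log {s : ℝ} (hs : 0 < s) :
    HasDerivAt (fun s => Real.exp (v (Real.log s)))
      (Real.exp (v (Real.log s)) * (v' (Real.log s) * s⁻¹)) s :=
  ((H.hasDerivAt _).comp s (Real.hasDerivAt_log hs.ne')).exp

lemma hasDerivAt_slope_log {s : ℝ} (hs : 0 < s) :
    HasDerivAt (fun s => v' (Real.log s))
      ((Real.exp (v (Real.log s)) ^ 2 - α * Real.exp (v (Real.log s))
        - s / Real.exp (v (Real.log s))) * s⁻¹) s := by
  refine ((H.hasDerivAt_slope _).comp s (Real.hasDerivAt_log hs.ne')).congr_deriv ?_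
  rw [painleveRHS, Real.exp_log hs]
  ring

lemma hasDerivAt_painlevePrimitive {s : ℝ} (hs : 0 < s) :
    HasDerivAt (painlevePrimitive α v v') (1 / Real.exp (v (Real.log s))) s := by
  have hq := H.hasDerivAt_exp_log hs
  have hv := H.hasDerivAt_slope_log hs
  have hq0 := (Real.exp_pos (v (Real.log s))).ne'
  have h1 : HasDerivAt (fun s => (1 / 4 + 2 * (s / Real.exp (v (Real.log s)))
      - 2 * α * Real.exp (v (Real.log s)) + Real.exp (v (Real.log s)) ^ 2
      - v' (Real.log s) ^ 2) / 2) _ s :=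
    (((((((hasDerivAt_id s).div hq hq0).const_mul 2).const_add (1 / 4)).sub
      (hq.const_mul (2 * α))).add (hq.pow 2)).sub (hv.pow 2)).div_const 2
  refine (h1.congr_of_eventuallyEq (painlevePrimitive_eventuallyEq hs)).congr_deriv ?_
  have hs' := hs.ne'
  simp only [id]
  generalize Real.exp (v (Real.log s)) = q at *
  generalize v' (Real.log s) = p at *
  push_cast
  field_simp
  ring

lemma hasDerivAt_deriv_painlevePrimitive {s : ℝ} (hs : 0 < s) :
    HasDerivAt (deriv (painlevePrimitive α v v'))
      (-v' (Real.log s) / (s * Real.exp (v (Real.log s)))) s := by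
  have hq0 := (Real.exp_pos (v (Real.log s))).ne'
  have h1 : HasDerivAt (fun s => 1 / Real.exp (v (Real.log s))) _ s :=
    (hasDerivAt_const s (1:ℝ)).div (H.hasDerivAt_exp_log hs) hq0
  refine (h1.congr_of_eventuallyEq ((lt_mem_nhds hs).mono fun x hx =>
    (H.hasDerivAt_painlevePrimitive hx).deriv)).congr_deriv ?_
  have hs' := hs.ne'
  field_simp
  ring

lemma hasDerivAt_deriv_deriv_painlevePrimitive {s : ℝ} (hs : 0 < s) :
    HasDerivAt (deriv (deriv (painlevePrimitive α v v')))
      ((-(Real.exp (v (Real.log s)) ^ 2 - α * Real.exp (v (Real.log s))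
        - s / Real.exp (v (Real.log s))) + v' (Real.log s) + v' (Real.log s) ^ 2)
        / (s ^ 2 * Real.exp (v (Real.log s)))) s := by
  have hq0 := (Real.exp_pos (v (Real.log s))).ne'
  have hs' := hs.ne'
  have h1 : HasDerivAt (fun s => -v' (Real.log s) / (s * Real.exp (v (Real.log s)))) _ s :=
    (H.hasDerivAt_slope_log hs).neg.div ((hasDerivAt_id s).mul (H.hasDerivAt_exp_log hs))
      (mul_ne_zero hs' hq0)
  refine (h1.congr_of_eventuallyEq ((lt_mem_nhds hs).mono fun x hx =>
    (H.hasDerivAt_deriv_painlevePrimitive hx).deriv)).congr_deriv ?_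
  simp only [id, Pi.neg_apply]
  generalize Real.exp (v (Real.log s)) = q at *
  generalize v' (Real.log s) = p at *
  field_simp
  ring

lemma painlevePrimitive_ode {s : ℝ} (hs : 0 < s) :
    2 * s ^ 2 * deriv (painlevePrimitive α v v') s
        * deriv (deriv (deriv (painlevePrimitive α v v'))) s
      - s ^ 2 * (deriv (deriv (painlevePrimitive α v v')) s) ^ 2
      + 2 * s * deriv (painlevePrimitive α v v') s * deriv (deriv (painlevePrimitive α v v')) s
      - 4 * s * (deriv (painlevePrimitive α v v') s) ^ 3
      + (2 * painlevePrimitive α v v' s - 1 / 4) * (deriv (painlevePrimitive α v v') s) ^ 2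
      + 1 = 0 := by
  rw [(H.hasDerivAt_deriv_deriv_painlevePrimitive hs).deriv,
    (H.hasDerivAt_deriv_painlevePrimitive hs).deriv, (H.hasDerivAt_painlevePrimitive hs).deriv,
    painlevePrimitive_eq hs]
  have hq0 := (Real.exp_pos (v (Real.log s))).ne'
  generalize Real.exp (v (Real.log s)) = q at *
  generalize v' (Real.log s) = p at *
  have hs' := hs.ne'
  field_simp
  ring

lemma tendsto_painlevePrimitive (hα : 0 < α) :
    Tendsto (painlevePrimitive α v v') (𝓝[>] 0) (𝓝 ((1 - 4 * α ^ 2) / 8)) := by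
  have hl := Real.tendsto_log_nhdsGT_zero
  have hq := (H.tendsto_atBot hα).comp hl
  have hp := (H.slope_tendsto_atBot hα).comp hl
  have hs : Tendsto (fun s : ℝ => s) (𝓝[>] 0) (𝓝 0) := tendsto_id.mono_left nhdsWithin_le_nhds
  have h := (((((hs.div hq hα.ne').const_mul 2).const_add (1 / 4)).sub
    (hq.const_mul (2 * α))).add (hq.pow 2)).sub (hp.pow 2) |>.div_const 2
  have e : (1 / 4 + 2 * (0 / α) - 2 * α * α + α ^ 2 - 0 ^ 2) / 2 = (1 - 4 * α ^ 2) / 8 := by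
    ring
  rw [e] at h
  refine h.congr' ?_
  filter_upwards [self_mem_nhdsWithin] with s hs
  rw [painlevePrimitive_eq hs]
  rfl

lemma abs_painlevePrimitive_sub_le (hα : 0 < α) {s : ℝ} (hs : 0 < s) :
    |painlevePrimitive α v v' s - (3 / 2 * s ^ ((2:ℝ) / 3) - α * s ^ ((1:ℝ) / 3))|
      ≤ 3 * (α + 1) ^ 2 + 2 * α * (α + 1) + 1 := by
  rw [painlevePrimitive_eq hs]
  have h1 := H.exp_le_add hα (Real.log s)
  have h2 := H.exp_div_three_le hα le_rfl (Real.log s)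
  have h3 := H.slope_nonneg hα (Real.log s)
  have h4 := H.slope_le_one hα (Real.log s)
  set x := s ^ ((1:ℝ) / 3) with hx
  have hx0 : 0 < x := Real.rpow_pos_of_pos hs _
  have e1 : Real.exp (Real.log s / 3) = x := by
    rw [hx, Real.rpow_def_of_pos hs]
    ring_nf
  have e2 : s ^ ((2:ℝ) / 3) = x ^ 2 := by
    rw [hx, ← Real.rpow_natCast, ← Real.rpow_mul hs.le]
    norm_num
  have e3 : s = x ^ 3 := by
    rw [hx, ← Real.rpow_natCast, ← Real.rpow_mul hs.le]
    norm_num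
  rw [e1] at h1 h2
  rw [e2]
  generalize Real.exp (v (Real.log s)) = q at *
  generalize v' (Real.log s) = p at *
  clear_value x
  subst e3
  have hq : 0 < q := by linarith
  obtain ⟨e, rfl⟩ : ∃ e, q = x + e := ⟨q - x, by ring⟩
  have e4 : 2 * (x ^ 3 / (x + e)) - 2 * α * (x + e) + (x + e) ^ 2
      = 3 * x ^ 2 - 2 * α * x + (e ^ 2 * (1 + 2 * (x / (x + e))) - 2 * α * e) := by
    field_simp
    ring
  have h5 : x / (x + e) ≤ 1 := by
    rw [div_le_one hq]
    linarith
  have he0 : 0 ≤ e := by linarith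
  have he1 : e ≤ α + 1 := by linarith
  have h7 : e ^ 2 ≤ (α + 1) ^ 2 := by gcongr
  have h8 : α * e ≤ α * (α + 1) := by gcongr
  have h9 : 0 ≤ α * e := by positivity
  have h10 : p ^ 2 ≤ 1 := by nlinarith
  have h11 : 0 ≤ e ^ 2 * (x / (x + e)) := by positivity
  have h12 : e ^ 2 * (x / (x + e)) ≤ e ^ 2 := by nlinarith [sq_nonneg e]
  rw [abs_le]
  constructor <;> nlinarith [sq_nonneg p, sq_nonneg e]

end IsPainleveSol

namespace IsPainleveSol

variable {α : ℝ} {v v' : ℝ → ℝ} (H : IsPainleveSol α 0 v v') (hα : 0 < α)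
include H hα

lemma painlevePrimitive_sub_eq {a b : ℝ} (ha : 0 ≤ a) (hab : a < b) : ∃ c ∈ Ioo a b,
    painlevePrimitive α v v' b - painlevePrimitive α v v' a
      = (b - a) * (1 / Real.exp (v (Real.log c))) := by
  have hcont : ContinuousOn (painlevePrimitive α v v') (Icc a b) := fun x hx => by
    rcases (ha.trans hx.1).eq_or_lt with h | h
    · subst h
      have h0 : painlevePrimitive α v v' 0 = (1 - 4 * α ^ 2) / 8 := if_neg (lt_irrefl _)
      have h1 : ContinuousWithinAt (painlevePrimitive α v v') (Ioi 0) 0 := by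
        rw [ContinuousWithinAt, h0]
        exact H.tendsto_painlevePrimitive hα
      exact (continuousWithinAt_Ioi_iff_Ici.mp h1).mono fun y hy => ha.trans hy.1
    · exact (H.hasDerivAt_painlevePrimitive h).continuousAt.continuousWithinAt
  obtain ⟨c, hc, hce⟩ := exists_hasDerivAt_eq_slope (painlevePrimitive α v v')
    (fun s => 1 / Real.exp (v (Real.log s))) hab hcont
    fun x hx => H.hasDerivAt_painlevePrimitive (ha.trans_lt hx.1)
  refine ⟨c, hc, ?_⟩
  have : b - a ≠ 0 := (sub_pos.mpr hab).ne'
  rw [hce]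
  field_simp

lemma one_div_exp_anti {a b : ℝ} (ha : 0 < a) (hab : a ≤ b) :
    1 / Real.exp (v (Real.log b)) ≤ 1 / Real.exp (v (Real.log a)) :=
  one_div_le_one_div_of_le (Real.exp_pos _)
    (Real.exp_le_exp.mpr (H.monotone hα (Real.log_le_log ha hab)))

omit hα in
lemma one_div_exp_le (hα : 0 < α) (θ : ℝ) : 1 / Real.exp (v θ) ≤ 1 / α :=
  one_div_le_one_div_of_le hα (H.le_exp θ)

lemma mul_le_painlevePrimitive_sub {a b c : ℝ} (ha : 0 ≤ a) (hab : a ≤ b) (hbc : b ≤ c) :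
    (b - a) * (1 / Real.exp (v (Real.log c)))
      ≤ painlevePrimitive α v v' b - painlevePrimitive α v v' a := by
  rcases hab.eq_or_lt with rfl | hab
  · simp
  obtain ⟨x, hx, he⟩ := H.painlevePrimitive_sub_eq hα ha hab
  rw [he]
  exact mul_le_mul_of_nonneg_left
    (H.one_div_exp_anti hα (ha.trans_lt hx.1) (hx.2.le.trans hbc)) (by linarith)

lemma painlevePrimitive_sub_le_mul {a b : ℝ} (ha : 0 < a) (hab : a < b) :
    painlevePrimitive α v v' b - painlevePrimitive α v v' a
      ≤ (b - a) * (1 / Real.exp (v (Real.log a))) := by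
  obtain ⟨x, hx, he⟩ := H.painlevePrimitive_sub_eq hα ha.le hab
  rw [he]
  exact mul_le_mul_of_nonneg_left (H.one_div_exp_anti hα ha hx.1.le) (by linarith)

lemma painlevePrimitive_sub_le_div {a b : ℝ} (ha : 0 ≤ a) (hab : a < b) :
    painlevePrimitive α v v' b - painlevePrimitive α v v' a ≤ (b - a) * (1 / α) := by
  obtain ⟨x, hx, he⟩ := H.painlevePrimitive_sub_eq hα ha hab
  rw [he]
  exact mul_le_mul_of_nonneg_left (H.one_div_exp_le hα _) (by linarith)

/-- Riemann sums of `e^{-v(log s)}` on the grid `(2j + 1 + α) t`. -/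
lemma abs_riemann_sum_sub_le {t : ℝ} (ht : 0 < t) (n : ℕ) :
    |t * ∑ j ∈ Finset.range n, 1 / Real.exp (v (Real.log (laguerreScale α j * t)))
      - (painlevePrimitive α v v' (2 * n * t) - painlevePrimitive α v v' 0) / 2|
      ≤ (1 + α) / α * t := by
  have hN := fun j => laguerreScale_pos hα j
  have hNt := fun j => mul_pos (hN j) ht
  set c : ℕ → ℝ := fun j => 1 / Real.exp (v (Real.log (laguerreScale α j * t))) with hc
  set F := painlevePrimitive α v v' with hF
  have hupper : ∀ m : ℕ, 2 * t * ∑ j ∈ Finset.range (m + 1), c j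
      ≤ 2 * t * (1 / α) + (F (2 * m * t) - F 0) := by
    intro m
    induction m with
    | zero =>
      have h := H.one_div_exp_le hα (Real.log (laguerreScale α 0 * t))
      have h2 := mul_le_mul_of_nonneg_left h (show 0 ≤ 2 * t by linarith)
      simpa [hc] using h2
    | succ m ih =>
      rw [Finset.sum_range_succ, mul_add]
      have h := H.mul_le_painlevePrimitive_sub hα (a := 2 * m * t) (b := 2 * (m + 1 : ℕ) * t)
        (c := laguerreScale α (m + 1) * t) (by positivity) (by gcongr; simp)
        (by unfold laguerreScale; gcongr; linarith)
      have e : 2 * ((m + 1 : ℕ) : ℝ) * t - 2 * m * t = 2 * t := by push_cast; ring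
      rw [e] at h
      linarith
  have hlower : ∀ m : ℕ, F (laguerreScale α m * t) - F 0
      ≤ 2 * t * ∑ j ∈ Finset.range m, c j + (1 + α) * t * (1 / α) := by
    intro m
    induction m with
    | zero =>
      have h := H.painlevePrimitive_sub_le_div hα le_rfl (hNt 0)
      simpa [laguerreScale] using h
    | succ m ih =>
      rw [Finset.sum_range_succ, mul_add]
      have h := H.painlevePrimitive_sub_le_mul hα (hNt m) (b := laguerreScale α (m + 1) * t)
        (by unfold laguerreScale; gcongr; simp)
      have e : laguerreScale α (m + 1) * t - laguerreScale α m * t = 2 * t := by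
        unfold laguerreScale
        push_cast
        ring
      rw [e] at h
      linarith
  have hc0 : ∀ j, 0 ≤ c j := fun j => by positivity
  have h1 := hupper n
  rw [Finset.sum_range_succ, mul_add] at h1
  have h1' := mul_nonneg (show 0 ≤ 2 * t by linarith) (hc0 n)
  have h2 := hlower n
  have h3 : F (2 * n * t) ≤ F (laguerreScale α n * t) := by
    have hle : 2 * n * t ≤ laguerreScale α n * t := by unfold laguerreScale; gcongr; linarith
    have h := H.mul_le_painlevePrimitive_sub hα (a := 2 * n * t) (b := laguerreScale α n * t)
      (by positivity) hle le_rfl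
    have h0 : 0 ≤ (laguerreScale α n * t - 2 * n * t)
        * (1 / Real.exp (v (Real.log (laguerreScale α n * t)))) :=
      mul_nonneg (sub_nonneg.mpr hle) (by positivity)
    linarith
  have e1 : (1 + α) * t * (1 / α) = (1 + α) / α * t := by ring
  have e2 : (1 + α) / α * t = t * (1 / α) + t := by field_simp
  have h5 : 0 < t * (1 / α) := by positivity
  rw [abs_le]
  constructor <;> nlinarith

lemma painlevePrimitive_ge {s : ℝ} (hs : 0 < s) :
    s / (α + 1 + s ^ ((1:ℝ) / 3)) ≤ painlevePrimitive α v v' s - painlevePrimitive α v v' 0 := by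
  refine le_trans ?_ (H.mul_le_painlevePrimitive_sub hα le_rfl hs.le le_rfl)
  rw [sub_zero, div_eq_mul_one_div]
  refine mul_le_mul_of_nonneg_left (one_div_le_one_div_of_le (Real.exp_pos _) ?_) hs.le
  refine (H.exp_le_add hα _).trans_eq ?_
  rw [Real.rpow_def_of_pos hs]
  ring_nf

end IsPainleveSol

lemma abs_exp_neg_sub_le {u v m : ℝ} (hu : m ≤ u) (hv : m ≤ v) :
    |Real.exp (-u) - Real.exp (-v)| ≤ Real.exp (-m) * |u - v| := by
  wlog h : u ≤ v generalizing u v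
  · rw [abs_sub_comm, abs_sub_comm u]
    exact this hv hu (le_of_not_ge h)
  rw [abs_of_nonneg (sub_nonneg.mpr (Real.exp_le_exp.mpr (by linarith))),
    abs_of_nonpos (by linarith)]
  have h1 := Real.add_one_le_exp (u - v)
  have e : Real.exp (-v) = Real.exp (-u) * Real.exp (u - v) := by rw [← Real.exp_add]; ring_nf
  have h2 : Real.exp (-u) ≤ Real.exp (-m) := Real.exp_le_exp.mpr (by linarith)
  have h3 : Real.exp (-u) * (1 - Real.exp (u - v)) ≤ Real.exp (-u) * (v - u) :=
    mul_le_mul_of_nonneg_left (by linarith) (Real.exp_pos _).le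
  have h4 := mul_le_mul_of_nonneg_right h2 (sub_nonneg.mpr h)
  rw [e]
  linarith

lemma abs_laguerreMean_sub_le {α d t : ℝ} (hα : 0 < α) (ht : 0 < t) (htd : t ≤ d) (j : ℕ)
    {v v' : ℝ → ℝ} (H : IsPainleveSol α 0 v v')
    (hv : ∀ x, |laguerreLog α j x - v x|
      ≤ 1 / laguerreScale α j ^ 2 * (1 + Real.exp (2 / 3 * x))) :
    |laguerreMean α j t - 1 / Real.exp (v (Real.log (laguerreScale α j * t)))|
      ≤ 1 / α * (1 + d ^ ((2:ℝ) / 3)) * (1 / ((j + 1 : ℕ) : ℝ) ^ ((4:ℝ) / 3)) := by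
  have hN := laguerreScale_pos hα j
  have hN1 := one_le_laguerreScale hα j
  have hNt := mul_pos hN ht
  set θ := Real.log (laguerreScale α j * t) with hθ
  have e1 : Real.exp (-laguerreLog α j θ) = laguerreMean α j t := by
    rw [Real.exp_neg, exp_laguerreLog hα, hθ, Real.exp_log hNt, mul_div_cancel_left₀ _ hN.ne',
      one_div, inv_inv]
  have h1 := abs_exp_neg_sub_le ((isPainleveSol_laguerreLog hα j).log_le hα θ) (H.log_le hα θ)
  rw [e1, Real.exp_neg (v θ), Real.exp_neg (Real.log α), Real.exp_log hα, ← one_div,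
    ← one_div] at h1
  refine h1.trans ?_
  rw [mul_assoc]
  refine mul_le_mul_of_nonneg_left ((hv θ).trans ?_) (by positivity)
  have e2 : Real.exp (2 / 3 * θ) = laguerreScale α j ^ ((2:ℝ) / 3) * t ^ ((2:ℝ) / 3) := by
    rw [← Real.mul_rpow hN.le ht.le, Real.rpow_def_of_pos hNt, mul_comm]
  have h2 : t ^ ((2:ℝ) / 3) ≤ d ^ ((2:ℝ) / 3) := Real.rpow_le_rpow ht.le htd (by norm_num)
  have h3 : 1 ≤ laguerreScale α j ^ ((2:ℝ) / 3) := Real.one_le_rpow hN1 (by norm_num)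
  have h4 : 0 < t ^ ((2:ℝ) / 3) := Real.rpow_pos_of_pos ht _
  have h5 : 1 + Real.exp (2 / 3 * θ)
      ≤ (1 + d ^ ((2:ℝ) / 3)) * laguerreScale α j ^ ((2:ℝ) / 3) := by
    rw [e2]
    nlinarith
  have e3 : 1 / laguerreScale α j ^ 2 * laguerreScale α j ^ ((2:ℝ) / 3)
      = 1 / laguerreScale α j ^ ((4:ℝ) / 3) := by
    have : laguerreScale α j ^ 2
        = laguerreScale α j ^ ((4:ℝ) / 3) * laguerreScale α j ^ ((2:ℝ) / 3) := by
      rw [← Real.rpow_add hN, ← Real.rpow_natCast]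
      norm_num
    rw [this]
    have := (Real.rpow_pos_of_pos hN ((4:ℝ) / 3)).ne'
    field_simp
  have h6 : ((j + 1 : ℕ) : ℝ) ≤ laguerreScale α j := by
    unfold laguerreScale
    push_cast
    linarith
  have h7 : 1 / laguerreScale α j ^ ((4:ℝ) / 3) ≤ 1 / ((j + 1 : ℕ) : ℝ) ^ ((4:ℝ) / 3) :=
    one_div_le_one_div_of_le (Real.rpow_pos_of_pos (by positivity) _)
      (Real.rpow_le_rpow (by positivity) h6 (by norm_num))
  have h8 : 0 ≤ 1 + d ^ ((2:ℝ) / 3) := by linarith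
  calc 1 / laguerreScale α j ^ 2 * (1 + Real.exp (2 / 3 * θ))
      ≤ 1 / laguerreScale α j ^ 2 * ((1 + d ^ ((2:ℝ) / 3)) * laguerreScale α j ^ ((2:ℝ) / 3)) :=
        mul_le_mul_of_nonneg_left h5 (by positivity)
    _ = (1 + d ^ ((2:ℝ) / 3)) * (1 / laguerreScale α j ^ ((4:ℝ) / 3)) := by
        rw [← e3]; ring
    _ ≤ _ := mul_le_mul_of_nonneg_left h7 h8

lemma exists_abs_sum_laguerreMean_sub_le {α d : ℝ} (hα : 0 < α) {v v' : ℝ → ℝ}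
    (hd : 0 < d) (H : IsPainleveSol α 0 v v')
    (hv : ∀ j x, |laguerreLog α j x - v x|
      ≤ 1 / laguerreScale α j ^ 2 * (1 + Real.exp (2 / 3 * x))) :
    ∃ K > 0, ∀ n : ℕ, ∀ t ∈ Ioc 0 d, |t * ∑ j ∈ Finset.range n, laguerreMean α j t
      - (painlevePrimitive α v v' (2 * n * t) - painlevePrimitive α v v' 0) / 2| ≤ K * t := by
  have hsum : Summable fun j : ℕ => 1 / ((j + 1 : ℕ) : ℝ) ^ ((4:ℝ) / 3) :=
    (summable_nat_add_iff 1).mpr (Real.summable_one_div_nat_rpow.mpr (by norm_num))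
  refine ⟨1 / α * (1 + d ^ ((2:ℝ) / 3)) * (∑' j : ℕ, 1 / ((j + 1 : ℕ) : ℝ) ^ ((4:ℝ) / 3))
    + (1 + α) / α, by positivity, fun n t ht => ?_⟩
  have h1 := H.abs_riemann_sum_sub_le hα ht.1 n
  have h2 : |∑ j ∈ Finset.range n, laguerreMean α j t
      - ∑ j ∈ Finset.range n, 1 / Real.exp (v (Real.log (laguerreScale α j * t)))|
      ≤ 1 / α * (1 + d ^ ((2:ℝ) / 3)) * ∑' j : ℕ, 1 / ((j + 1 : ℕ) : ℝ) ^ ((4:ℝ) / 3) := by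
    rw [← Finset.sum_sub_distrib]
    refine (Finset.abs_sum_le_sum_abs _ _).trans ((Finset.sum_le_sum fun j _ =>
      abs_laguerreMean_sub_le hα ht.1 ht.2 j H (hv j)).trans ?_)
    rw [← Finset.mul_sum]
    exact mul_le_mul_of_nonneg_left (hsum.sum_le_tsum _ fun j _ => by positivity) (by positivity)
  generalize ∑ j ∈ Finset.range n, laguerreMean α j t = x at *
  generalize ∑ j ∈ Finset.range n, 1 / Real.exp (v (Real.log (laguerreScale α j * t))) = y at *
  refine (abs_sub_le _ (t * y) _).trans ?_
  rw [← mul_sub, abs_mul, abs_of_pos ht.1]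
  have h3 := mul_le_mul_of_nonneg_left h2 ht.1.le
  linarith

theorem H_n_asymptotics (α d : ℝ) (hα : 0 < α) (hd : 0 < d) :
    ∃ r : ℝ → ℝ,
      (∀ s > (0:ℝ), ContDiffAt ℝ (⊤ : ℕ∞) r s) ∧
      (∀ s > (0:ℝ),
        2 * s ^ 2 * deriv r s * deriv (deriv (deriv r)) s
          - s ^ 2 * (deriv (deriv r) s) ^ 2
          + 2 * s * deriv r s * deriv (deriv r) s
          - 4 * s * (deriv r s) ^ 3
          + (2 * r s - 1 / 4) * (deriv r s) ^ 2 + 1 = 0) ∧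
      Tendsto r (𝓝[>] (0:ℝ)) (𝓝 ((1 - 4 * α ^ 2) / 8)) ∧
      (∃ M > (0:ℝ), ∃ s₁ > (0:ℝ), ∀ s ≥ s₁,
        |r s - ((3 / 2) * s ^ ((2:ℝ) / 3) - α * s ^ ((1:ℝ) / 3))| ≤ M) ∧
      ∃ C > (0:ℝ), ∃ N : ℕ, ∀ n ≥ N, ∀ t ∈ Ioc (0:ℝ) d,
        ∃ ε : ℝ, |ε| ≤ C * (n : ℝ) ^ (-(1:ℝ) / 3) ∧
          Hlog α n t
            = -((8 * r (2 * n * t) + 4 * α ^ 2 - 1) / 16) * (1 + ε) := by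
  obtain ⟨v, v', H, hv⟩ := exists_laguerreLog_limit hα
  obtain ⟨K, hK, hKb⟩ := exists_abs_sum_laguerreMean_sub_le hα hd H hv
  refine ⟨painlevePrimitive α v v', fun s hs => H.contDiffAt_painlevePrimitive hs,
    fun s hs => H.painlevePrimitive_ode hs, H.tendsto_painlevePrimitive hα,
    ⟨3 * (α + 1) ^ 2 + 2 * α * (α + 1) + 1, by positivity, 1, one_pos, fun s hs =>
      H.abs_painlevePrimitive_sub_le hα (lt_of_lt_of_le one_pos hs)⟩,
    K * (α + 1 + (2 * d) ^ ((1:ℝ) / 3)), by positivity, 1, fun n hn t ht => ?_⟩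
  have ht0 := ht.1
  have hn1 : (1:ℝ) ≤ n := by exact_mod_cast hn
  have hn0 : (0:ℝ) < n := by linarith
  have hs : 0 < 2 * n * t := by positivity
  have h0 : painlevePrimitive α v v' 0 = (1 - 4 * α ^ 2) / 8 := if_neg (lt_irrefl _)
  have h1 := hKb n t ht
  have h2 := H.painlevePrimitive_ge hα hs
  set I := (painlevePrimitive α v v' (2 * n * t) - painlevePrimitive α v v' 0) / 2 with hI
  have eI : (8 * painlevePrimitive α v v' (2 * n * t) + 4 * α ^ 2 - 1) / 16 = I := by
    rw [hI, h0]
    ring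
  have hy1 : 1 ≤ (n:ℝ) ^ ((1:ℝ) / 3) := Real.one_le_rpow hn1 (by norm_num)
  have hD : (2 * n * t) ^ ((1:ℝ) / 3) ≤ (2 * d) ^ ((1:ℝ) / 3) * (n:ℝ) ^ ((1:ℝ) / 3) := by
    rw [← Real.mul_rpow (by positivity) hn0.le]
    refine Real.rpow_le_rpow hs.le ?_ (by norm_num)
    have := mul_le_mul_of_nonneg_left ht.2 (show 0 ≤ 2 * (n:ℝ) by positivity)
    linarith
  have ey : (n:ℝ) = ((n:ℝ) ^ ((1:ℝ) / 3)) ^ 3 := by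
    rw [← Real.rpow_natCast, ← Real.rpow_mul hn0.le]
    norm_num
  have ey' : (n:ℝ) ^ (-(1:ℝ) / 3) = 1 / (n:ℝ) ^ ((1:ℝ) / 3) := by
    rw [neg_div, Real.rpow_neg hn0.le, inv_eq_one_div]
  have hd2 : 0 ≤ (2 * d) ^ ((1:ℝ) / 3) := by positivity
  have hB : 0 < α + 1 + (2 * d) ^ ((1:ℝ) / 3) := by linarith
  have hIge : t * (n:ℝ) ^ ((1:ℝ) / 3) / (α + 1 + (2 * d) ^ ((1:ℝ) / 3)) ≤ I := by
    have h3 : α + 1 + (2 * n * t) ^ ((1:ℝ) / 3)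
        ≤ (α + 1 + (2 * d) ^ ((1:ℝ) / 3)) * (n:ℝ) ^ ((1:ℝ) / 3) := by nlinarith
    have h4 : 2 * n * t / ((α + 1 + (2 * d) ^ ((1:ℝ) / 3)) * (n:ℝ) ^ ((1:ℝ) / 3))
        ≤ 2 * n * t / (α + 1 + (2 * n * t) ^ ((1:ℝ) / 3)) := by
      gcongr
    have h5 : t * (n:ℝ) ^ ((1:ℝ) / 3) / (α + 1 + (2 * d) ^ ((1:ℝ) / 3))
        ≤ n * t / ((α + 1 + (2 * d) ^ ((1:ℝ) / 3)) * (n:ℝ) ^ ((1:ℝ) / 3)) := by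
      rw [div_le_div_iff₀ hB (by positivity)]
      have h6 : ((n:ℝ) ^ ((1:ℝ) / 3)) ^ 2 ≤ n := by
        conv_rhs => rw [ey]
        exact pow_le_pow_right₀ hy1 (by norm_num)
      have h7 := mul_le_mul_of_nonneg_left h6
        (show 0 ≤ t * (α + 1 + (2 * d) ^ ((1:ℝ) / 3)) by positivity)
      linarith
    rw [hI]
    have h8 : 2 * n * t / ((α + 1 + (2 * d) ^ ((1:ℝ) / 3)) * (n:ℝ) ^ ((1:ℝ) / 3))
        = 2 * (n * t / ((α + 1 + (2 * d) ^ ((1:ℝ) / 3)) * (n:ℝ) ^ ((1:ℝ) / 3))) := by ring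
    linarith
  have hIpos : 0 < I := lt_of_lt_of_le (by positivity) hIge
  refine ⟨(t * ∑ j ∈ Finset.range n, laguerreMean α j t - I) / I, ?_, ?_⟩
  · rw [abs_div, abs_of_pos hIpos, div_le_iff₀ hIpos, ey']
    refine h1.trans ?_
    have h9 := mul_le_mul_of_nonneg_left hIge
      (show 0 ≤ K * (α + 1 + (2 * d) ^ ((1:ℝ) / 3)) * (1 / (n:ℝ) ^ ((1:ℝ) / 3)) by positivity)
    refine le_trans (le_of_eq ?_) h9
    have := hB.ne'
    field_simp
  · rw [eI, Hlog_eq_sum α ht0]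
    field_simp
    ring
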